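/- arXiv:2401.08533 — 2 statements merged into one kernel-verified Lean document; each statement's English description precedes it below -/
import Mathlib

section
/- Assume 0 < κ < a and that ξ lies in the open interval (τ(a − √(a²−κ²)), τ(a + √(a²−κ²))). Then there exists a constant C > 0, depending only on L, a, κ, τ and ξ, such that every smooth solution (u,θ) of the thermoelastic beam with delayed heat conduction and zero-order coupling satisfies, for all t > 0, E(t) ≤ (C/t²)·( E(0) + Q₀ ), where Q₀ = ∫₀^L u_txx(x,0)² dx + ∫₀^L ( −u_xxxx(x,0) + θ(x,0) )² dx + ∫₀^L ( κ·θ_xx(x,−τ) + a·θ_xx(x,0) − u_t(x,0) )² dx + ξ·∫₀^L ∫₀¹ θ_tx(x,−τρ)² dρ dx. -/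
open MeasureTheory intervalIntegral

/-- Partial derivative in the space variable of `f : ℝ → ℝ → ℝ` (first argument). -/
noncomputable def pdX (f : ℝ → ℝ → ℝ) (x t : ℝ) : ℝ := deriv (fun y => f y t) x

/-- Partial derivative in the time variable of `f : ℝ → ℝ → ℝ` (second argument). -/
noncomputable def pdT (f : ℝ → ℝ → ℝ) (x t : ℝ) : ℝ := deriv (fun s => f x s) t

/-- A smooth solution of the thermoelastic beam with delayed heat conduction and
zero-order coupling:
`u_tt + u_xxxx − θ = 0`, `θ_t − κ·θ_xx(·,·−τ) − a·θ_xx + u_t = 0` on `(0,L)×(0,∞)`,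
with hinged boundary conditions for `u` and Dirichlet conditions for `θ`. -/
structure IsSmoothSolDHBeam0 (L τ a κ : ℝ) (u θ : ℝ → ℝ → ℝ) : Prop where
  smooth_u : ContDiff ℝ (⊤ : ℕ∞) (fun p : ℝ × ℝ => u p.1 p.2)
  smooth_θ : ContDiff ℝ (⊤ : ℕ∞) (fun p : ℝ × ℝ => θ p.1 p.2)
  pde_u : ∀ x ∈ Set.Ioo (0 : ℝ) L, ∀ t > (0 : ℝ),
    pdT (pdT u) x t + pdX (pdX (pdX (pdX u))) x t - θ x t = 0
  pde_θ : ∀ x ∈ Set.Ioo (0 : ℝ) L, ∀ t > (0 : ℝ),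
    pdT θ x t - κ * pdX (pdX θ) x (t - τ) - a * pdX (pdX θ) x t + pdT u x t = 0
  bc_u : ∀ t : ℝ, 0 ≤ t →
    u 0 t = 0 ∧ u L t = 0 ∧ pdX (pdX u) 0 t = 0 ∧ pdX (pdX u) L t = 0
  bc_θ : ∀ t : ℝ, -τ ≤ t → θ 0 t = 0 ∧ θ L t = 0

/-- The energy of the thermoelastic beam with delayed heat conduction. -/
noncomputable def energyDHBeam (L τ ξ : ℝ) (u θ : ℝ → ℝ → ℝ) (t : ℝ) : ℝ :=
  (1 / 2) * ((∫ x in (0 : ℝ)..L, ((pdT u x t) ^ 2 + (pdX (pdX u) x t) ^ 2 + (θ x t) ^ 2))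
    + ξ * ∫ x in (0 : ℝ)..L, ∫ ρ in (0 : ℝ)..(1 : ℝ), (pdX θ x (t - τ * ρ)) ^ 2)

/-- The squared graph norm of the initial state of a solution of the thermoelastic
beam with delayed heat conduction and zero-order coupling. -/
noncomputable def graphNormSqDHBeam0 (L τ a κ ξ : ℝ) (u θ : ℝ → ℝ → ℝ) : ℝ :=
  (∫ x in (0 : ℝ)..L, (pdX (pdX (pdT u)) x 0) ^ 2)
    + (∫ x in (0 : ℝ)..L, (-pdX (pdX (pdX (pdX u))) x 0 + θ x 0) ^ 2)
    + (∫ x in (0 : ℝ)..L,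
        (κ * pdX (pdX θ) x (-τ) + a * pdX (pdX θ) x 0 - pdT u x 0) ^ 2)
    + ξ * ∫ x in (0 : ℝ)..L, ∫ ρ in (0 : ℝ)..(1 : ℝ), (pdX (pdT θ) x (-τ * ρ)) ^ 2

lemma hist_hasDerivAt {τ : ℝ} (hτ : 0 < τ) {f : ℝ → ℝ} (hf : Continuous f) (t : ℝ) :
    HasDerivAt (fun t => ∫ ρ in (0:ℝ)..1, f (t - τ * ρ)) ((f t - f (t - τ)) / τ) t := by
  have h1 : (fun t => ∫ ρ in (0:ℝ)..1, f (t - τ * ρ)) =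
      fun t => τ⁻¹ * ((∫ s in (0:ℝ)..t, f s) - ∫ s in (0:ℝ)..(t - τ), f s) := by
    funext t
    rw [intervalIntegral.integral_comp_sub_mul f hτ.ne' t,
      intervalIntegral.integral_interval_sub_left (hf.intervalIntegrable _ _)
      (hf.intervalIntegrable _ _)]
    simp
  rw [h1]
  have hF : ∀ t, HasDerivAt (fun t => ∫ s in (0:ℝ)..t, f s) (f t) t := fun t =>
    intervalIntegral.integral_hasDerivAt_right (hf.intervalIntegrable _ _)
      (hf.stronglyMeasurableAtFilter _ _) hf.continuousAt
  have h2 : HasDerivAt (fun t => ∫ s in (0:ℝ)..(t - τ), f s) (f (t - τ)) t := by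
    have := (hF (t - τ)).comp t ((hasDerivAt_id t).sub_const τ)
    simpa [Function.comp_def] using this
  have := ((hF t).sub h2).const_mul τ⁻¹
  rw [div_eq_inv_mul]
  exact this

lemma hist_W {τ : ℝ} (hτ : 0 < τ) {f : ℝ → ℝ} (hf : Continuous f) (hf0 : ∀ t, 0 ≤ f t) :
    ∃ W : ℝ → ℝ, (∀ t, HasDerivAt W ((f t - ∫ ρ in (0:ℝ)..1, f (t - τ * ρ)) / τ) t) ∧
      (∀ t, 0 ≤ W t) ∧ (∀ t, W t ≤ ∫ ρ in (0:ℝ)..1, f (t - τ * ρ)) := by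
  set F : ℝ → ℝ := fun t => ∫ s in (0:ℝ)..t, f s with hFdef
  have hF : ∀ t, HasDerivAt F (f t) t := fun t =>
    intervalIntegral.integral_hasDerivAt_right (hf.intervalIntegrable _ _)
      (hf.stronglyMeasurableAtFilter _ _) hf.continuousAt
  have hFc : Continuous F := continuous_iff_continuousAt.2 fun t => (hF t).continuousAt
  have hmono : Monotone F := monotone_of_deriv_nonneg (fun t => (hF t).differentiableAt)
    (fun t => by rw [(hF t).deriv]; exact hf0 t)
  have hH : ∀ t, ∫ ρ in (0:ℝ)..1, f (t - τ * ρ) = (F t - F (t - τ)) / τ := by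
    intro t
    rw [intervalIntegral.integral_comp_sub_mul f hτ.ne' t, hFdef,
      intervalIntegral.integral_interval_sub_left (hf.intervalIntegrable _ _)
      (hf.intervalIntegrable _ _)]
    simp; field_simp
  refine ⟨fun t => (F t - ∫ ρ in (0:ℝ)..1, F (t - τ * ρ)) / τ, ?_, ?_, ?_⟩
  · intro t
    rw [hH]
    exact ((hF t).sub (hist_hasDerivAt hτ hFc t)).div_const τ
  · intro t
    apply div_nonneg _ hτ.le
    have : ∫ ρ in (0:ℝ)..1, F (t - τ * ρ) ≤ ∫ ρ in (0:ℝ)..1, F t := by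
      apply intervalIntegral.integral_mono_on zero_le_one
      · exact (by fun_prop : Continuous fun ρ => F (t - τ * ρ)).intervalIntegrable _ _
      · simp
      · intro x hx; apply hmono; nlinarith [hx.1]
    simp at this; linarith
  · intro t
    rw [hH]
    apply div_le_div_of_nonneg_right _ hτ.le
    have : ∫ ρ in (0:ℝ)..1, F (t - τ) ≤ ∫ ρ in (0:ℝ)..1, F (t - τ * ρ) := by
      apply intervalIntegral.integral_mono_on zero_le_one
      · simp
      · exact (by fun_prop : Continuous fun ρ => F (t - τ * ρ)).intervalIntegrable _ _
      · intro x hx; apply hmono; nlinarith [hx.2]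
    simp at this; linarith

lemma gronwall_exp {y y' : ℝ → ℝ} {δ : ℝ} (hc : Continuous y)
    (hd : ∀ t > 0, HasDerivAt y (y' t) t) (hle : ∀ t > 0, y' t ≤ -δ * y t) (t : ℝ) (ht : 0 ≤ t) :
    y t ≤ Real.exp (-(δ * t)) * y 0 := by
  have hz : ∀ t > 0, HasDerivAt (fun t => Real.exp (δ * t) * y t)
      (Real.exp (δ * t) * δ * y t + Real.exp (δ * t) * y' t) t := by
    intro t ht
    have h1 : HasDerivAt (fun t => Real.exp (δ * t)) (Real.exp (δ * t) * δ) t := by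
      have := ((hasDerivAt_id t).const_mul δ).exp
      simpa using this
    exact h1.mul (hd t ht)
  have hanti : AntitoneOn (fun t => Real.exp (δ * t) * y t) (Set.Ici 0) := by
    apply antitoneOn_of_deriv_nonpos (convex_Ici 0)
    · exact (by fun_prop : Continuous fun t => Real.exp (δ * t) * y t).continuousOn
    · intro t ht
      rw [interior_Ici] at ht
      exact (hz t ht).differentiableAt.differentiableWithinAt
    · intro t ht
      rw [interior_Ici] at ht
      rw [(hz t ht).deriv]
      have := hle t ht
      nlinarith [Real.exp_pos (δ * t)]
  have h := hanti (Set.mem_Ici.2 le_rfl) (Set.mem_Ici.2 ht) ht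
  simp at h
  rw [Real.exp_neg, inv_mul_eq_div, le_div_iff₀ (Real.exp_pos _)]
  linarith

lemma quad_form {A B κ : ℝ} (hA : 0 < A) (hB : 0 < B) (h : κ ^ 2 < A * B) :
    ∃ c > 0, ∀ x y : ℝ, c * (x ^ 2 + y ^ 2) ≤ A * x ^ 2 + 2 * κ * x * y + B * y ^ 2 := by
  have hc : 0 < (A * B - κ ^ 2) / (A + B) := div_pos (by linarith) (by linarith)
  refine ⟨(A * B - κ ^ 2) / (A + B), hc, fun x y => ?_⟩
  set c := (A * B - κ ^ 2) / (A + B) with hcdef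
  have hce : c * (A + B) = A * B - κ ^ 2 := by rw [hcdef]; field_simp
  have hAc : 0 < A - c := by nlinarith [sq_nonneg κ]
  have key : (A - c) * ((A - c) * x ^ 2 + 2 * κ * x * y + (B - c) * y ^ 2) =
     ((A - c) * x + κ * y) ^ 2 + c ^ 2 * y ^ 2 := by
    linear_combination (-y ^ 2) * hce
  have : 0 ≤ (A - c) * x ^ 2 + 2 * κ * x * y + (B - c) * y ^ 2 := by
    by_contra hneg
    push Not at hneg
    have := mul_neg_of_pos_of_neg hAc hneg
    nlinarith [sq_nonneg ((A - c) * x + κ * y), sq_nonneg (c * y)]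
  linarith

/-- Energy of a mode -/
noncomputable def modeE (τ ξ μ : ℝ) (u v θ : ℝ → ℝ) (t : ℝ) : ℝ :=
  v t ^ 2 + μ ^ 2 * u t ^ 2 + θ t ^ 2 + ξ * μ * ∫ ρ in (0:ℝ)..1, θ (t - τ * ρ) ^ 2

/-- The modal system -/
structure ModeSol (τ a κ μ : ℝ) (u v θ : ℝ → ℝ) : Prop where
  cu : Continuous u
  cv : Continuous v
  cθ : Continuous θ
  du : ∀ t > 0, HasDerivAt u (v t) t
  dv : ∀ t > 0, HasDerivAt v (-μ ^ 2 * u t + θ t) t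
  dθ : ∀ t > 0, HasDerivAt θ (-κ * μ * θ (t - τ) - a * μ * θ t - v t) t

lemma lyap_K {a κ m μ C1 : ℝ} (hκ : 0 < κ) (hκa : κ < a) (hm : 0 < m) (hμ : μ ≥ m)
    (u v θ θτ : ℝ) (hC1 : C1 = 8 * a ^ 2 + 16 + 4 / m ^ 2 + 1 / m ^ 4) :
    4 * ((-κ * μ * θτ - a * μ * θ - v) * v + θ * (-μ ^ 2 * u + θ))
        + (v * v + u * (-μ ^ 2 * u + θ)) ≤
        -(1 / 2) * (v ^ 2 + μ ^ 2 * u ^ 2) + C1 * μ ^ 2 * (θ ^ 2 + θτ ^ 2) := by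
  have hμp : 0 < μ := lt_of_lt_of_le hm hμ
  have hmμ : m ^ 2 ≤ μ ^ 2 := by gcongr
  have b1 : 4 * ((-κ * μ * θτ - a * μ * θ) * v) ≤ v ^ 2 + 8 * a ^ 2 * μ ^ 2 * (θ ^ 2 + θτ ^ 2) := by
    have s1 : 4 * ((-κ * μ * θτ - a * μ * θ) * v) ≤ v ^ 2 + 4 * (κ * μ * θτ + a * μ * θ) ^ 2 := by
      nlinarith [sq_nonneg (v + 2 * (κ * μ * θτ + a * μ * θ))]
    have s2 : (κ * μ * θτ + a * μ * θ) ^ 2 ≤ 2 * ((κ * μ * θτ) ^ 2 + (a * μ * θ) ^ 2) := by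
      nlinarith [sq_nonneg (κ * μ * θτ - a * μ * θ)]
    have s3 : (κ * μ * θτ) ^ 2 ≤ (a * μ * θτ) ^ 2 := by
      have : κ ^ 2 ≤ a ^ 2 := by gcongr
      have := mul_le_mul_of_nonneg_right this (by positivity : 0 ≤ μ ^ 2 * θτ ^ 2)
      linarith
    linarith
  have b2 : 4 * (θ * (-μ ^ 2 * u)) ≤ μ ^ 2 * u ^ 2 / 4 + 16 * μ ^ 2 * θ ^ 2 := by
    nlinarith [sq_nonneg (μ * u / 2 + 4 * μ * θ)]
  have b3 : u * θ ≤ μ ^ 2 * u ^ 2 / 4 + θ ^ 2 / μ ^ 2 := by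
    have := sq_nonneg (μ * u / 2 - θ / μ)
    have h2 : (μ * u / 2 - θ / μ) ^ 2 = μ ^ 2 * u ^ 2 / 4 - u * θ + θ ^ 2 / μ ^ 2 := by
      field_simp; ring
    linarith
  have b4 : 4 * θ ^ 2 ≤ 4 / m ^ 2 * μ ^ 2 * θ ^ 2 := by
    have : 1 ≤ μ ^ 2 / m ^ 2 := by rw [le_div_iff₀ (by positivity)]; linarith
    have e : 4 / m ^ 2 * μ ^ 2 * θ ^ 2 = 4 * θ ^ 2 * (μ ^ 2 / m ^ 2) := by ring
    rw [e]; exact le_mul_of_one_le_right (by positivity) this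
  have b5 : θ ^ 2 / μ ^ 2 ≤ 1 / m ^ 4 * μ ^ 2 * θ ^ 2 := by
    rw [div_le_iff₀ (by positivity)]
    have : 1 ≤ μ ^ 4 / m ^ 4 := by
      rw [le_div_iff₀ (by positivity), one_mul]; gcongr
    have e : 1 / m ^ 4 * μ ^ 2 * θ ^ 2 * μ ^ 2 = θ ^ 2 * (μ ^ 4 / m ^ 4) := by ring
    rw [e]; exact le_mul_of_one_le_right (by positivity) this
  have b6 : 0 ≤ (16 + 4 / m ^ 2 + 1 / m ^ 4) * μ ^ 2 * θτ ^ 2 := by positivity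
  rw [hC1]
  linarith [sq_nonneg v]

set_option maxHeartbeats 1000000 in
/-- Constant selection for Lyapunov -/
lemma lyap_alg {a κ τ ξ m c0 : ℝ} (hτ : 0 < τ) (hκ : 0 < κ) (hκa : κ < a) (hξ : 0 < ξ)
    (hm : 0 < m) (hc0 : 0 < c0) :
    ∃ ε > 0, ∃ ε' > 0, ∃ g > 0, ε' ≤ ξ ∧ ∀ μ ≥ m, ∀ u v θ θτ H W Q : ℝ,
      0 ≤ W → W ≤ H → c0 * (θ ^ 2 + θτ ^ 2) ≤ Q →
      ∀ E K L : ℝ, E = v ^ 2 + μ ^ 2 * u ^ 2 + θ ^ 2 + ξ * μ * H →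
      K = 4 * (θ * v) + u * v →
      L = E + (ε / μ) * K + ε' * μ * W →
      E / 2 ≤ L ∧ L ≤ (5 / 2) * E ∧
      -μ * Q + (ε / μ) * (4 * ((-κ * μ * θτ - a * μ * θ - v) * v + θ * (-μ ^ 2 * u + θ))
        + (v * v + u * (-μ ^ 2 * u + θ))) + ε' * μ * ((θ ^ 2 - H) / τ) ≤ -(g / μ) * L := by
  obtain ⟨C1, hC1⟩ : ∃ C1, C1 = 8 * a ^ 2 + 16 + 4 / m ^ 2 + 1 / m ^ 4 := ⟨_, rfl⟩
  have hC1p : 0 < C1 := by rw [hC1]; positivity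
  obtain ⟨ε, hε⟩ : ∃ ε, ε = min (c0 / (4 * C1)) (m / (2 * (3 + 1 / m ^ 2))) := ⟨_, rfl⟩
  have hεp : 0 < ε := by rw [hε]; apply lt_min <;> positivity
  obtain ⟨ε', hε'⟩ : ∃ ε', ε' = min (c0 * τ / 4) ξ := ⟨_, rfl⟩
  have hε'p : 0 < ε' := by rw [hε']; apply lt_min <;> positivity
  obtain ⟨g, hg⟩ : ∃ g, g = min (ε / 2) (min (c0 * m ^ 2 / 2) (ε' * m / (τ * ξ))) := ⟨_, rfl⟩
  have hgp : 0 < g := by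
    rw [hg]
    apply lt_min; positivity
    apply lt_min <;> positivity
  refine ⟨ε, hεp, ε', hε'p, 2 * g / 5, by positivity, hε'.le.trans (min_le_right _ _), ?_⟩
  intro μ hμ u v θ θτ H W Q hW hWH hQ E K L hEd hKdef hLd
  have hμp : 0 < μ := lt_of_lt_of_le hm hμ
  have hH : 0 ≤ H := hW.trans hWH
  have e1 : ε * C1 ≤ c0 / 4 := by
    have : ε ≤ c0 / (4 * C1) := hε.le.trans (min_le_left _ _)
    rw [le_div_iff₀ (by positivity)] at this; linarith
  have e2 : ε * (3 + 1 / m ^ 2) ≤ m / 2 := by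
    have : ε ≤ m / (2 * (3 + 1 / m ^ 2)) := hε.le.trans (min_le_right _ _)
    rw [le_div_iff₀ (by positivity)] at this; linarith
  have e3 : ε' / τ ≤ c0 / 4 := by
    have : ε' ≤ c0 * τ / 4 := hε'.le.trans (min_le_left _ _)
    rw [div_le_iff₀ hτ]; linarith
  have e4 : ε' ≤ ξ := hε'.le.trans (min_le_right _ _)
  have hE0 : 0 ≤ E := by rw [hEd]; positivity
  have hu2 : u ^ 2 ≤ μ ^ 2 * u ^ 2 * (1 / m ^ 2) := by
    have h1 : 1 ≤ μ ^ 2 * (1 / m ^ 2) := by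
      rw [mul_one_div, le_div_iff₀ (by positivity), one_mul]; gcongr
    have := mul_le_mul_of_nonneg_left h1 (sq_nonneg u)
    linarith
  have hμH : 0 ≤ ξ * μ * H := by positivity
  have hm2 : 0 < 1 / m ^ 2 := by positivity
  have hK : |K| ≤ (3 + 1 / m ^ 2) * E := by
    have : |K| ≤ 2 * (θ ^ 2 + v ^ 2) + (u ^ 2 + v ^ 2) / 2 := by
      rw [abs_le]; constructor <;> rw [hKdef] <;>
      nlinarith [sq_nonneg (θ + v), sq_nonneg (θ - v), sq_nonneg (u + v), sq_nonneg (u - v)]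
    have hx : (3 + 1 / m ^ 2) * E = 3 * E + (1 / m ^ 2) * E := by ring
    have hy : μ ^ 2 * u ^ 2 * (1 / m ^ 2) ≤ (1 / m ^ 2) * E := by
      rw [mul_comm]; apply mul_le_mul_of_nonneg_left _ hm2.le
      rw [hEd]; linarith [sq_nonneg v, sq_nonneg θ]
    have hz : v ^ 2 + θ ^ 2 ≤ E := by rw [hEd]; linarith [sq_nonneg (μ * u)]
    linarith [sq_nonneg θ, sq_nonneg v, sq_nonneg u]
  have hKE : |ε / μ * K| ≤ E / 2 := by
    rw [abs_mul, abs_of_pos (by positivity : 0 < ε / μ), div_mul_eq_mul_div, div_le_iff₀ hμp]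
    have h1 : ε * |K| ≤ ε * ((3 + 1 / m ^ 2) * E) := mul_le_mul_of_nonneg_left hK hεp.le
    have h2 : ε * (3 + 1 / m ^ 2) * E ≤ m / 2 * E := mul_le_mul_of_nonneg_right e2 hE0
    have h3 : m / 2 * E ≤ μ / 2 * E := mul_le_mul_of_nonneg_right (by linarith) hE0
    linarith
  rw [abs_le] at hKE
  have hWE : ε' * μ * W ≤ E := by
    have h1 : ε' * μ * W ≤ ξ * μ * H := by gcongr
    rw [hEd]; linarith [sq_nonneg v, sq_nonneg θ, sq_nonneg (μ * u)]
  have hW0 : 0 ≤ ε' * μ * W := by positivity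
  refine ⟨by rw [hLd]; linarith, by rw [hLd]; linarith, ?_⟩
  have hLE : L ≤ (5 / 2) * E := by rw [hLd]; linarith
  have hKd := lyap_K hκ hκa hm hμ u v θ θτ hC1
  have hKd2 := mul_le_mul_of_nonneg_left hKd (by positivity : 0 ≤ ε / μ)
  have r1 : (ε / μ) * (-(1 / 2) * (v ^ 2 + μ ^ 2 * u ^ 2) + C1 * μ ^ 2 * (θ ^ 2 + θτ ^ 2)) =
      -(ε / 2 / μ) * (v ^ 2 + μ ^ 2 * u ^ 2) + (ε * C1) * (μ * (θ ^ 2 + θτ ^ 2)) := by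
    field_simp
  rw [r1] at hKd2
  have r2 : (ε * C1) * (μ * (θ ^ 2 + θτ ^ 2)) ≤ c0 / 4 * (μ * (θ ^ 2 + θτ ^ 2)) :=
    mul_le_mul_of_nonneg_right e1 (by positivity)
  have r3 : ε' * μ * ((θ ^ 2 - H) / τ) ≤ c0 / 4 * (μ * θ ^ 2) - ε' / τ * μ * H := by
    have : ε' * μ * ((θ ^ 2 - H) / τ) = ε' / τ * (μ * θ ^ 2) - ε' / τ * μ * H := by ring
    rw [this]
    have := mul_le_mul_of_nonneg_right e3 (by positivity : 0 ≤ μ * θ ^ 2)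
    linarith
  have r4 : μ * (c0 * (θ ^ 2 + θτ ^ 2)) ≤ μ * Q := mul_le_mul_of_nonneg_left hQ hμp.le
  have g1 : g / μ * (v ^ 2 + μ ^ 2 * u ^ 2) ≤ (ε / 2 / μ) * (v ^ 2 + μ ^ 2 * u ^ 2) := by
    have : g ≤ ε / 2 := hg.le.trans (min_le_left _ _)
    gcongr
  have g2 : g / μ * θ ^ 2 ≤ c0 / 2 * μ * θ ^ 2 := by
    have h1 : g ≤ c0 * m ^ 2 / 2 := (hg.le.trans (min_le_right _ _)).trans (min_le_left _ _)
    apply mul_le_mul_of_nonneg_right _ (sq_nonneg _)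
    rw [div_le_iff₀ hμp]
    have : c0 * m ^ 2 ≤ c0 * μ ^ 2 := by gcongr
    linarith
  have g3 : g / μ * (ξ * μ * H) ≤ ε' / τ * μ * H := by
    have h1 : g ≤ ε' * m / (τ * ξ) := (hg.le.trans (min_le_right _ _)).trans (min_le_right _ _)
    have h2 : g / μ * (ξ * μ * H) = (g * ξ) * H := by field_simp
    rw [h2]
    apply mul_le_mul_of_nonneg_right _ hH
    rw [le_div_iff₀ (by positivity)] at h1
    rw [div_mul_eq_mul_div, le_div_iff₀ hτ]
    have : ε' * m ≤ ε' * μ := by gcongr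
    linarith
  have hfin : -(2 * g / 5 / μ) * L ≥ -(g / μ) * E := by
    have : (2 * g / 5 / μ) * L ≤ (2 * g / 5 / μ) * ((5 / 2) * E) := by gcongr
    have e : (2 * g / 5 / μ) * ((5 / 2) * E) = g / μ * E := by ring
    linarith
  have hE : g / μ * E = g / μ * (v ^ 2 + μ ^ 2 * u ^ 2) + g / μ * θ ^ 2 + g / μ * (ξ * μ * H) := by
    rw [hEd]; ring
  have p1 : 0 ≤ μ * θ ^ 2 := by positivity
  have p2 : 0 ≤ c0 * (μ * θτ ^ 2) := by positivity
  linarith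

lemma hist_nonneg (τ : ℝ) (θ : ℝ → ℝ) (t : ℝ) :
    0 ≤ ∫ ρ in (0:ℝ)..1, θ (t - τ * ρ) ^ 2 :=
  intervalIntegral.integral_nonneg zero_le_one fun _ _ => sq_nonneg _

lemma hist_continuous {τ : ℝ} (hτ : 0 < τ) {f : ℝ → ℝ} (hf : Continuous f) :
    Continuous (fun t => ∫ ρ in (0:ℝ)..1, f (t - τ * ρ)) :=
  continuous_iff_continuousAt.2 fun t => (hist_hasDerivAt hτ hf t).continuousAt

lemma mode_energy_decay {a κ τ ξ m c0 : ℝ} (hτ : 0 < τ) (hκ : 0 < κ) (hκa : κ < a) (hξ : 0 < ξ)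
    (hm : 0 < m) (hc0 : 0 < c0)
    (hq : ∀ x y : ℝ, c0 * (x ^ 2 + y ^ 2) ≤
      (2 * a - ξ / τ) * x ^ 2 + 2 * κ * x * y + (ξ / τ) * y ^ 2) :
    ∃ γ > 0, ∀ μ ≥ m, ∀ u v θ : ℝ → ℝ, ModeSol τ a κ μ u v θ → ∀ t ≥ 0,
      modeE τ ξ μ u v θ t ≤ 5 * Real.exp (-(γ / μ * t)) * modeE τ ξ μ u v θ 0 := by
  obtain ⟨ε, hε, ε', hε', g, hg, hεξ, hly⟩ := lyap_alg hτ hκ hκa hξ hm hc0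
  refine ⟨g, hg, fun μ hμ u v θ hs t ht => ?_⟩
  have hμp : 0 < μ := lt_of_lt_of_le hm hμ
  have hθ2 : Continuous fun s => θ s ^ 2 := hs.cθ.pow 2
  obtain ⟨W, hWd, hW0, hWH⟩ := hist_W hτ hθ2 (fun t => sq_nonneg _)
  have hHd := hist_hasDerivAt hτ hθ2
  have hHc := hist_continuous hτ hθ2
  have hWc : Continuous W := continuous_iff_continuousAt.2 fun t => (hWd t).continuousAt
  obtain ⟨L, hL⟩ : ∃ L : ℝ → ℝ, L = fun t => modeE τ ξ μ u v θ t
     + (ε / μ) * (4 * (θ t * v t) + u t * v t) + ε' * μ * W t := ⟨_, rfl⟩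
  have key := fun t => hly μ hμ (u t) (v t) (θ t) (θ (t - τ)) _ (W t) _ (hW0 t) (hWH t)
    (hq (θ t) (θ (t - τ))) (modeE τ ξ μ u v θ t) _ (L t) rfl rfl (by rw [hL])
  have hLc : Continuous L := by
    rw [hL]
    have := hs.cu; have := hs.cv; have := hs.cθ
    unfold modeE
    fun_prop
  have hLd : ∀ t > 0, HasDerivAt L (-μ * ((2 * a - ξ / τ) * θ t ^ 2 + 2 * κ * θ t * θ (t - τ)
        + (ξ / τ) * θ (t - τ) ^ 2) + (ε / μ) * (4 * ((-κ * μ * θ (t - τ) - a * μ * θ t - v t) * v t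
        + θ t * (-μ ^ 2 * u t + θ t)) + (v t * v t + u t * (-μ ^ 2 * u t + θ t)))
        + ε' * μ * ((θ t ^ 2 - ∫ ρ in (0:ℝ)..1, θ (t - τ * ρ) ^ 2) / τ)) t := by
    intro t ht
    have h1 := (((((hs.dv t ht).pow 2).add (((hs.du t ht).pow 2).const_mul (μ ^ 2))).add
      ((hs.dθ t ht).pow 2)).add ((hHd t).const_mul (ξ * μ))).add
      ((((((hs.dθ t ht).mul (hs.dv t ht)).const_mul 4).add
      ((hs.du t ht).mul (hs.dv t ht))).const_mul (ε / μ)))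
    have h2 := h1.add ((hWd t).const_mul (ε' * μ))
    rw [hL]
    refine HasDerivAt.congr_deriv (f := fun t => modeE τ ξ μ u v θ t
     + (ε / μ) * (4 * (θ t * v t) + u t * v t) + ε' * μ * W t) h2 ?_
    simp only [Nat.cast_ofNat]
    ring
  have hgr := gronwall_exp hLc hLd (fun t ht => (key t).2.2) t ht
  have k1 := (key t).1
  have k2 := (key 0).2.1
  have := mul_le_mul_of_nonneg_left k2 (Real.exp_pos (-(g / μ * t))).le
  linarith

lemma exp_le_sq {x : ℝ} (hx : 0 < x) : Real.exp (-x) ≤ 2 / x ^ 2 := by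
  rw [Real.exp_neg, ← one_div, div_le_div_iff₀ (Real.exp_pos _) (by positivity)]
  nlinarith [Real.quadratic_le_exp_of_nonneg hx.le]

lemma mode_decay {a κ τ ξ m : ℝ} (hτ : 0 < τ) (hκ : 0 < κ) (hκa : κ < a) (hξ : 0 < ξ)
    (hm : 0 < m) (hA : 0 < 2 * a - ξ / τ) (hd : κ ^ 2 < (2 * a - ξ / τ) * (ξ / τ)) :
    ∃ C > 0, ∀ μ ≥ m, ∀ u v w θ φ : ℝ → ℝ, ModeSol τ a κ μ u v θ → ModeSol τ a κ μ v w φ →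
      (∀ t ≥ 0, w t = -μ ^ 2 * u t + θ t) → ∀ t > 0,
      modeE τ ξ μ u v θ t ≤ C / t ^ 2 * (modeE τ ξ μ u v θ 0 + modeE τ ξ μ v w φ 0) := by
  obtain ⟨c0, hc0, hq⟩ := quad_form hA (div_pos hξ hτ) hd
  obtain ⟨γ0, hγ0, hdec⟩ := mode_energy_decay hτ hκ hκa hξ hm hc0 hq
  obtain ⟨ε', hε'⟩ : ∃ ε', ε' = min (c0 * τ / 4) ξ := ⟨_, rfl⟩
  have hε'p : 0 < ε' := by rw [hε']; apply lt_min <;> positivity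
  have e3 : ε' / τ ≤ c0 / 4 := by
    have : ε' ≤ c0 * τ / 4 := hε'.le.trans (min_le_left _ _)
    rw [div_le_iff₀ hτ]; linarith
  have e4 : ε' ≤ ξ := hε'.le.trans (min_le_right _ _)
  obtain ⟨δ, hδ⟩ : ∃ δ, δ = min (c0 * m / 2) (ε' / (2 * τ * ξ)) := ⟨_, rfl⟩
  have hδp : 0 < δ := by rw [hδ]; apply lt_min <;> positivity
  have d1 : δ ≤ c0 * m / 2 := hδ.le.trans (min_le_left _ _)
  have d2 : δ * (2 * ξ) ≤ ε' / τ := by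
    have : δ ≤ ε' / (2 * τ * ξ) := hδ.le.trans (min_le_right _ _)
    rw [le_div_iff₀ (by positivity)] at this
    rw [le_div_iff₀ (by positivity)]
    linarith
  obtain ⟨γ, hγ⟩ : ∃ γ, γ = min γ0 (δ * m / 2) := ⟨_, rfl⟩
  have hγp : 0 < γ := by rw [hγ]; apply lt_min <;> positivity
  have g1 : γ ≤ γ0 := hγ.le.trans (min_le_left _ _)
  have g2 : γ ≤ δ * m / 2 := hγ.le.trans (min_le_right _ _)
  obtain ⟨A1, hA1⟩ : ∃ A1, A1 = (1 + 2 / m ^ 2) * 2 := ⟨_, rfl⟩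
  obtain ⟨A2, hA2⟩ : ∃ A2, A2 = (1 + 2 / m ^ 2) * (40 / (δ * c0 * m)) + 15 := ⟨_, rfl⟩
  have hA1p : 0 < A1 := by rw [hA1]; positivity
  have hA2p : 0 < A2 := by rw [hA2]; positivity
  refine ⟨A1 * (2 / δ ^ 2) + A2 * (2 / γ ^ 2), by positivity, ?_⟩
  intro μ hμ u v w θ φ hs hs1 hw t ht
  have hμp : 0 < μ := lt_of_lt_of_le hm hμ
  obtain ⟨Q, hQ⟩ : ∃ Q, Q = modeE τ ξ μ v w φ 0 := ⟨_, rfl⟩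
  have hξμ : 0 < ξ * μ := by positivity
  have hQ0 : 0 ≤ Q := by
    rw [hQ]; unfold modeE
    have := mul_nonneg hξμ.le (hist_nonneg τ φ 0)
    positivity
  have hE1 : ∀ t ≥ 0, modeE τ ξ μ v w φ t ≤ 5 * Real.exp (-(γ / μ * t)) * Q := by
    intro t ht
    refine (hdec μ hμ v w φ hs1 t ht).trans ?_
    rw [hQ] at hQ0 ⊢
    gcongr
  have hμv : ∀ t ≥ 0, w t ^ 2 + μ ^ 2 * v t ^ 2 ≤ 5 * Real.exp (-(γ / μ * t)) * Q := by
    intro t ht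
    refine le_trans ?_ (hE1 t ht)
    have := mul_nonneg hξμ.le (hist_nonneg τ φ t)
    unfold modeE
    linarith [sq_nonneg (φ t)]
  have hθ2 : Continuous fun s => θ s ^ 2 := hs.cθ.pow 2
  obtain ⟨W, hWd, hW0, hWH⟩ := hist_W hτ hθ2 (fun t => sq_nonneg _)
  have hHd := hist_hasDerivAt hτ hθ2
  have hHc := hist_continuous hτ hθ2
  have hWc : Continuous W := continuous_iff_continuousAt.2 fun t => (hWd t).continuousAt
  obtain ⟨H, hH⟩ : ∃ H : ℝ → ℝ, H = fun t => ∫ ρ in (0:ℝ)..1, θ (t - τ * ρ) ^ 2 := ⟨_, rfl⟩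
  have hH0 : ∀ t, 0 ≤ H t := fun t => by rw [hH]; exact hist_nonneg τ θ t
  rw [← hH] at hHc
  replace hHd : ∀ t, HasDerivAt H ((θ t ^ 2 - θ (t - τ) ^ 2) / τ) t := fun t => by
    rw [hH]; exact hHd t
  replace hWH : ∀ t, W t ≤ H t := fun t => by rw [hH]; exact hWH t
  replace hWd : ∀ t, HasDerivAt W ((θ t ^ 2 - H t) / τ) t := fun t => by
    rw [hH]; exact hWd t
  have hEH : ∀ t, modeE τ ξ μ u v θ t = v t ^ 2 + μ ^ 2 * u t ^ 2 + θ t ^ 2 + ξ * μ * H t :=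
    fun t => by rw [hH]; rfl
  obtain ⟨M, hM⟩ : ∃ M, M = 40 / (δ * c0 * m) * (Q / μ ^ 2) := ⟨_, rfl⟩
  have hM0 : 0 ≤ M := by rw [hM]; positivity
  obtain ⟨G, hG⟩ : ∃ G : ℝ → ℝ, G = fun t => θ t ^ 2 + ξ * μ * H t + ε' * μ * W t := ⟨_, rfl⟩
  have hGle : ∀ t, G t ≤ θ t ^ 2 + 2 * ξ * μ * H t := by
    intro t
    rw [hG]
    have : ε' * μ * W t ≤ ξ * μ * H t := by
      have := hWH t; have := hW0 t
      gcongr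
    simp only; linarith
  have hGd : ∀ t > 0, HasDerivAt G (-μ * ((2 * a - ξ / τ) * θ t ^ 2 + 2 * κ * θ t * θ (t - τ)
        + (ξ / τ) * θ (t - τ) ^ 2) - 2 * (v t * θ t)
        + ε' * μ * ((θ t ^ 2 - H t) / τ)) t := by
    intro t ht
    have h1 := (((hs.dθ t ht).pow 2).add ((hHd t).const_mul (ξ * μ))).add
      ((hWd t).const_mul (ε' * μ))
    rw [hG]
    refine HasDerivAt.congr_deriv (f := fun t => θ t ^ 2 + ξ * μ * H t + ε' * μ * W t) h1 ?_
    simp only [Nat.cast_ofNat]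
    ring
  have hGdle : ∀ t > 0, (-μ * ((2 * a - ξ / τ) * θ t ^ 2 + 2 * κ * θ t * θ (t - τ)
        + (ξ / τ) * θ (t - τ) ^ 2) - 2 * (v t * θ t)
        + ε' * μ * ((θ t ^ 2 - H t) / τ)) ≤ -δ * G t + δ / 2 * (M * Real.exp (-(γ / μ * t))) := by
    intro t ht
    have q1 := mul_le_mul_of_nonneg_left (hq (θ t) (θ (t - τ))) hμp.le
    have q2 : -2 * (v t * θ t) ≤ c0 / 4 * μ * θ t ^ 2 + 4 / (c0 * μ) * v t ^ 2 := by
      have h := sq_nonneg (c0 * μ * θ t + 4 * v t)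
      have e : c0 / 4 * μ * θ t ^ 2 + 4 / (c0 * μ) * v t ^ 2 + 2 * (v t * θ t)
        = (c0 * μ * θ t + 4 * v t) ^ 2 / (4 * c0 * μ) := by field_simp; ring
      have : 0 ≤ (c0 * μ * θ t + 4 * v t) ^ 2 / (4 * c0 * μ) := by positivity
      linarith
    have q3 : ε' * μ * ((θ t ^ 2 - H t) / τ) ≤ c0 / 4 * (μ * θ t ^ 2) - ε' / τ * (μ * H t) := by
      have : ε' * μ * ((θ t ^ 2 - H t) / τ) = ε' / τ * (μ * θ t ^ 2) - ε' / τ * (μ * H t) := by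
        ring
      rw [this]
      have := mul_le_mul_of_nonneg_right e3 (by positivity : 0 ≤ μ * θ t ^ 2)
      linarith
    have q4 : δ * G t ≤ δ * (θ t ^ 2 + 2 * ξ * μ * H t) := mul_le_mul_of_nonneg_left (hGle t) hδp.le
    have q5 : δ * θ t ^ 2 ≤ c0 / 2 * μ * θ t ^ 2 := by
      have : c0 * m ≤ c0 * μ := by gcongr
      apply mul_le_mul_of_nonneg_right _ (sq_nonneg _)
      linarith
    have q6 : δ * (2 * ξ) * (μ * H t) ≤ ε' / τ * (μ * H t) :=
      mul_le_mul_of_nonneg_right d2 (mul_nonneg hμp.le (hH0 t))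
    have q7 : 4 / (c0 * μ) * v t ^ 2 ≤ δ / 2 * (M * Real.exp (-(γ / μ * t))) := by
      have h1 : μ ^ 2 * v t ^ 2 ≤ 5 * Real.exp (-(γ / μ * t)) * Q := by
        linarith [hμv t ht.le, sq_nonneg (w t)]
      have h2 : δ / 2 * (M * Real.exp (-(γ / μ * t))) =
          4 / (c0 * m) * ((5 * Real.exp (-(γ / μ * t)) * Q) / μ ^ 2) := by
        rw [hM]; field_simp; ring
      rw [h2]
      have h3 : v t ^ 2 ≤ (5 * Real.exp (-(γ / μ * t)) * Q) / μ ^ 2 := by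
        rw [le_div_iff₀ (by positivity)]; linarith
      have h4 : 4 / (c0 * μ) ≤ 4 / (c0 * m) := by gcongr
      exact mul_le_mul h4 h3 (sq_nonneg _) (by positivity)
    have q8 : 0 ≤ c0 * (μ * θ (t - τ) ^ 2) := by positivity
    linarith
  have hGc : Continuous G := by
    rw [hG]; have := hs.cθ; fun_prop
  have hzd : ∀ t > 0, HasDerivAt (fun t => G t - M * Real.exp (-(γ / μ * t)))
      ((-μ * ((2 * a - ξ / τ) * θ t ^ 2 + 2 * κ * θ t * θ (t - τ)
        + (ξ / τ) * θ (t - τ) ^ 2) - 2 * (v t * θ t)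
        + ε' * μ * ((θ t ^ 2 - H t) / τ)) + γ / μ * (M * Real.exp (-(γ / μ * t)))) t := by
    intro t ht
    have h1 : HasDerivAt (fun t => Real.exp (-(γ / μ * t))) (Real.exp (-(γ / μ * t)) * -(γ / μ)) t := by
      have := (((hasDerivAt_id t).const_mul (γ / μ)).neg).exp
      simpa using this
    refine ((hGd t ht).sub (h1.const_mul M)).congr_deriv ?_
    ring
  have hγμ : γ / μ ≤ δ / 2 := by
    rw [div_le_iff₀ hμp]
    have : δ * m ≤ δ * μ := by gcongr
    linarith
  have hgr := gronwall_exp (δ := δ) (by fun_prop) hzd (by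
    intro t ht
    have h1 := hGdle t ht
    have h2 : γ / μ * (M * Real.exp (-(γ / μ * t))) ≤ δ / 2 * (M * Real.exp (-(γ / μ * t))) :=
      mul_le_mul_of_nonneg_right hγμ (by positivity)
    linarith) t ht.le
  have hG0 : G 0 ≤ 2 * modeE τ ξ μ u v θ 0 := by
    have h1 := hGle 0
    have h2 := hEH 0
    have : 0 ≤ μ ^ 2 * u 0 ^ 2 := by positivity
    linarith [sq_nonneg (v 0), sq_nonneg (θ 0)]
  have hGt : G t ≤ Real.exp (-(δ * t)) * (2 * modeE τ ξ μ u v θ 0)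
      + M * Real.exp (-(γ / μ * t)) := by
    have : Real.exp (-(δ * t)) * (G 0 - M * Real.exp (-(γ / μ * 0))) ≤
      Real.exp (-(δ * t)) * (2 * modeE τ ξ μ u v θ 0) := by
      apply mul_le_mul_of_nonneg_left _ (Real.exp_pos _).le
      have : 0 ≤ M * Real.exp (-(γ / μ * 0)) := by positivity
      linarith
    linarith
  have hWt : 0 ≤ ε' * μ * W t := mul_nonneg (by positivity) (hW0 t)
  have hHt : 0 ≤ ξ * μ * H t := mul_nonneg (by positivity) (hH0 t)
  have hGt' : G t = θ t ^ 2 + ξ * μ * H t + ε' * μ * W t := by rw [hG]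
  have hu : μ ^ 2 * u t ^ 2 + v t ^ 2 ≤ 2 / m ^ 2 * G t +
      3 * (5 * Real.exp (-(γ / μ * t)) * Q / μ ^ 2) := by
    have h1 : (μ ^ 2 * u t) ^ 2 ≤ 2 * (θ t ^ 2 + w t ^ 2) := by
      have : μ ^ 2 * u t = θ t - w t := by rw [hw t ht.le]; ring
      rw [this]; linarith [sq_nonneg (θ t + w t)]
    have h2 := hμv t ht.le
    have h3 : μ ^ 2 * (μ ^ 2 * u t ^ 2 + v t ^ 2) ≤ 2 * G t + 3 * (5 * Real.exp (-(γ / μ * t)) * Q) := by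
      have : 0 ≤ μ ^ 2 * v t ^ 2 := by positivity
      linarith [sq_nonneg (w t)]
    have h4 : μ ^ 2 * u t ^ 2 + v t ^ 2 ≤
        (2 * G t + 3 * (5 * Real.exp (-(γ / μ * t)) * Q)) / μ ^ 2 := by
      rw [le_div_iff₀ (by positivity)]; linarith
    have h5 : 2 * G t / μ ^ 2 ≤ 2 * G t / m ^ 2 := by
      have : 0 ≤ G t := by rw [hGt']; positivity
      gcongr
    have e : (2 * G t + 3 * (5 * Real.exp (-(γ / μ * t)) * Q)) / μ ^ 2 =
      2 * G t / μ ^ 2 + 3 * (5 * Real.exp (-(γ / μ * t)) * Q / μ ^ 2) := by ring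
    have e' : 2 / m ^ 2 * G t = 2 * G t / m ^ 2 := by ring
    linarith
  have hE0 : 0 ≤ modeE τ ξ μ u v θ 0 := by
    rw [hEH]
    have := hH0 0
    positivity
  have hfin : modeE τ ξ μ u v θ t ≤ A1 * (Real.exp (-(δ * t)) * modeE τ ξ μ u v θ 0)
      + A2 * (Real.exp (-(γ / μ * t)) / μ ^ 2 * Q) := by
    rw [hEH]
    have h1 : v t ^ 2 + μ ^ 2 * u t ^ 2 + θ t ^ 2 + ξ * μ * H t ≤ (1 + 2 / m ^ 2) * G t +
      3 * (5 * Real.exp (-(γ / μ * t)) * Q / μ ^ 2) := by linarith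
    refine h1.trans ?_
    have h2 := mul_le_mul_of_nonneg_left hGt (by positivity : 0 ≤ 1 + 2 / m ^ 2)
    refine (add_le_add_left h2 _).trans (le_of_eq ?_)
    rw [hA1, hA2, hM]
    ring
  refine hfin.trans ?_
  rw [← hQ]
  have x1 := exp_le_sq (by positivity : 0 < δ * t)
  have x2 := exp_le_sq (by positivity : 0 < γ / μ * t)
  have y1 : A1 * (Real.exp (-(δ * t)) * modeE τ ξ μ u v θ 0) ≤
    A1 * (2 / (δ * t) ^ 2 * modeE τ ξ μ u v θ 0) := by gcongr
  have y2 : A2 * (Real.exp (-(γ / μ * t)) / μ ^ 2 * Q) ≤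
    A2 * (2 / (γ / μ * t) ^ 2 / μ ^ 2 * Q) := by gcongr
  have z1 : A1 * (2 / (δ * t) ^ 2 * modeE τ ξ μ u v θ 0) =
    A1 * (2 / δ ^ 2) / t ^ 2 * modeE τ ξ μ u v θ 0 := by field_simp
  have z2 : A2 * (2 / (γ / μ * t) ^ 2 / μ ^ 2 * Q) = A2 * (2 / γ ^ 2) / t ^ 2 * Q := by field_simp
  have z3 : 0 ≤ A1 * (2 / δ ^ 2) / t ^ 2 * Q := by positivity
  have z4 : 0 ≤ A2 * (2 / γ ^ 2) / t ^ 2 * modeE τ ξ μ u v θ 0 := by positivity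
  rw [add_div]
  linarith

/-- extension with parity sign -/
noncomputable def parExt (σ : ℝ) (f : ℝ → ℝ) (x : ℝ) : ℝ := if 0 < x then f x else σ * f (-x)

lemma integral_parExt {L σ : ℝ} (hL : 0 < L) {f : ℝ → ℝ} (hf : Continuous f)
    (h : ℝ → ℝ → ℂ) (hh : Continuous fun p : ℝ × ℝ => h p.1 p.2) :
    ∫ x in (-L)..L, h x (parExt σ f x) =
      ∫ x in (0:ℝ)..L, (h x (f x) + h (-x) (σ * f x)) := by
  have c1 : ∀ x ∈ Set.Ioc (-L) 0, h x (parExt σ f x) = h x (σ * f (-x)) := by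
    intro x hx; simp [parExt, not_lt.2 hx.2]
  have c2 : ∀ x ∈ Set.Ioc 0 L, h x (parExt σ f x) = h x (f x) := by
    intro x hx; simp [parExt, hx.1]
  have k1 : Continuous fun x => h x (σ * f (-x)) :=
    hh.comp (by fun_prop : Continuous fun x => (x, σ * f (-x)))
  have k2 : Continuous fun x => h x (f x) :=
    hh.comp (by fun_prop : Continuous fun x => (x, f x))
  have k3 : Continuous fun x => h (-x) (σ * f x) :=
    hh.comp (by fun_prop : Continuous fun x => (-x, σ * f x))
  have i1 : ∫ x in (-L)..0, h x (parExt σ f x) = ∫ x in (-L)..0, h x (σ * f (-x)) := by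
    rw [integral_of_le (by linarith), integral_of_le (by linarith)]
    exact setIntegral_congr_fun measurableSet_Ioc c1
  have i2 : ∫ x in (0:ℝ)..L, h x (parExt σ f x) = ∫ x in (0:ℝ)..L, h x (f x) := by
    rw [integral_of_le (by linarith), integral_of_le (by linarith)]
    exact setIntegral_congr_fun measurableSet_Ioc c2
  have j1 : IntervalIntegrable (fun x => h x (parExt σ f x)) volume (-L) 0 := by
    refine (k1.intervalIntegrable (-L) 0).congr ?_
    rw [Set.uIoc_of_le (by linarith)]
    exact fun x hx => (c1 x hx).symm
  have j2 : IntervalIntegrable (fun x => h x (parExt σ f x)) volume 0 L := by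
    refine (k2.intervalIntegrable 0 L).congr ?_
    rw [Set.uIoc_of_le (by linarith)]
    exact fun x hx => (c2 x hx).symm
  rw [← integral_add_adjacent_intervals j1 j2, i1, i2,
    integral_add (k2.intervalIntegrable _ _) (k3.intervalIntegrable _ _), add_comm]
  congr 1
  have := intervalIntegral.integral_comp_neg (a := 0) (b := L) (fun x => h x (σ * f (-x)))
  simpa using this.symm

lemma parExt_parseval {L σ : ℝ} (hL : 0 < L) (hσ : σ ^ 2 = 1) {f : ℝ → ℝ} (hf : Continuous f) :
    HasSum (fun n : ℤ => ‖(1 / (2 * L) : ℂ) * ∫ x in (0:ℝ)..L,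
      (f x : ℂ) * (Complex.exp (-(Real.pi * n / L * x : ℝ) * Complex.I)
        + σ * Complex.exp ((Real.pi * n / L * x : ℝ) * Complex.I))‖ ^ 2)
      (L⁻¹ * ∫ x in (0:ℝ)..L, f x ^ 2) := by
  have hab : -L < L := by linarith
  have hmeas : Measurable (parExt σ f) := by
    unfold parExt
    exact Measurable.ite measurableSet_Ioi hf.measurable (by fun_prop)
  have hL2 : MemLp (fun x => (parExt σ f x : ℂ)) 2 (volume.restrict (Set.Ioc (-L) L)) := by
    obtain ⟨B, hB⟩ := (isCompact_Icc (a := -L) (b := L)).exists_bound_of_continuousOn hf.continuousOn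
    apply MemLp.of_bound (by fun_prop) B
    filter_upwards [ae_restrict_mem measurableSet_Ioc] with x hx
    have hs : |σ| = 1 := by
      rw [← sq_eq_sq₀ (abs_nonneg _) zero_le_one]; simpa using hσ
    rw [Complex.norm_real]
    unfold parExt
    split_ifs
    · exact hB x ⟨hx.1.le, hx.2⟩
    · rw [norm_mul, Real.norm_eq_abs σ, hs, one_mul]
      exact hB _ ⟨by linarith [hx.2], by linarith [hx.1]⟩
  have h := hasSum_sq_fourierCoeffOn hab hL2
  convert h using 1
  · funext n
    rw [fourierCoeffOn_eq_integral]
    have h1 := integral_parExt (σ := σ) hL hf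
      (fun x y => Complex.exp (-(Real.pi * n / L * x : ℝ) * Complex.I) * (y : ℂ)) (by fun_prop)
    have h2 : ∫ x in (-L)..L, (fourier (-n) (x : AddCircle (L - -L))) • (parExt σ f x : ℂ) =
        ∫ x in (-L)..L, Complex.exp (-(Real.pi * n / L * x : ℝ) * Complex.I) * (parExt σ f x : ℂ) := by
      apply intervalIntegral.integral_congr
      intro x _
      simp only [fourier_coe_apply, smul_eq_mul]
      congr 2
      have : (L : ℂ) ≠ 0 := by exact_mod_cast hL.ne'
      push_cast
      have h3 : (L : ℂ) - -L = 2 * L := by ring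
      rw [h3]
      field_simp
    rw [h2, h1]
    rw [Complex.real_smul]
    have h4 : ((1 / (L - -L) : ℝ) : ℂ) = 1 / (2 * L) := by
      push_cast
      congr 1; ring
    rw [h4]
    congr 3
    apply intervalIntegral.integral_congr
    intro x _
    simp only
    push_cast
    have e : -((Real.pi : ℂ) * n / L * -x) = Real.pi * n / L * x := by ring
    rw [e]; ring
  · have h1 := integral_parExt (σ := σ) hL hf (fun x y => ((y ^ 2 : ℝ) : ℂ)) (by fun_prop)
    have h2 : ∫ x in (-L)..L, ‖(parExt σ f x : ℂ)‖ ^ 2 = ∫ x in (-L)..L, parExt σ f x ^ 2 := by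
      apply intervalIntegral.integral_congr
      intro x _
      simp
    rw [h2]
    have h3 : ∀ x, (((f x) ^ 2 : ℝ) : ℂ) + (((σ * f x) ^ 2 : ℝ) : ℂ) = ((2 * f x ^ 2 : ℝ) : ℂ) := by
      intro x
      rw [mul_pow, hσ]; push_cast; ring
    simp only [h3, intervalIntegral.integral_ofReal] at h1
    have h4 := Complex.ofReal_injective h1
    rw [h4, intervalIntegral.integral_const_mul, smul_eq_mul]
    field_simp
    ring

lemma fold_sum {L S : ℝ} (hL : 0 < L) {b : ℤ → ℝ} (h0 : b 0 = 0) (hb : ∀ n, b (-n) = b n)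
    (h : HasSum (fun n => 1 / L ^ 2 * b n) (L⁻¹ * S)) :
    HasSum (fun n : ℕ => 2 / L * b (n + 1)) S := by
  have h2 := h.nat_add_neg
  simp only [hb, h0, mul_zero, add_zero] at h2
  have h3 := (hasSum_nat_add_iff' 1).2 h2
  have h4 := h3.mul_left L
  simp only [Finset.range_one, Finset.sum_singleton, Nat.cast_zero, h0, mul_zero, add_zero,
    sub_zero, Nat.cast_add, Nat.cast_one] at h4
  have e : L * (L⁻¹ * S) = S := by field_simp
  rw [e] at h4
  have e2 : (fun n : ℕ => 2 / L * b (n + 1)) =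
      fun i : ℕ => L * (1 / L ^ 2 * b (i + 1) + 1 / L ^ 2 * b (i + 1)) := by
    funext n
    field_simp; ring
  rw [e2]
  exact h4

lemma parseval_sin {L : ℝ} (hL : 0 < L) {f : ℝ → ℝ} (hf : Continuous f) :
    HasSum (fun n : ℕ => 2 / L * (∫ x in (0:ℝ)..L, f x * Real.sin (Real.pi * (n + 1) / L * x)) ^ 2)
      (∫ x in (0:ℝ)..L, f x ^ 2) := by
  have h := parExt_parseval (σ := -1) hL (by norm_num) hf
  have hco : ∀ n : ℤ, ‖(1 / (2 * L) : ℂ) * ∫ x in (0:ℝ)..L,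
      (f x : ℂ) * (Complex.exp (-(Real.pi * n / L * x : ℝ) * Complex.I)
        + (-1 : ℝ) * Complex.exp ((Real.pi * n / L * x : ℝ) * Complex.I))‖ ^ 2 =
        1 / L ^ 2 * (∫ x in (0:ℝ)..L, f x * Real.sin (Real.pi * n / L * x)) ^ 2 := by
    intro n
    have h1 : ∀ x : ℝ, (f x : ℂ) * (Complex.exp (-(Real.pi * n / L * x : ℝ) * Complex.I)
        + (-1 : ℝ) * Complex.exp ((Real.pi * n / L * x : ℝ) * Complex.I)) =
        (-2 * Complex.I) * ((f x * Real.sin (Real.pi * n / L * x) : ℝ) : ℂ) := by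
      intro x
      generalize Real.pi * n / L * x = z
      push_cast
      rw [Complex.sin, div_eq_mul_inv]
      linear_combination ((f x : ℂ) * (Complex.exp (-z * Complex.I)
        - Complex.exp (z * Complex.I))) * Complex.I_sq
    simp only [h1]
    rw [intervalIntegral.integral_const_mul, intervalIntegral.integral_ofReal]
    simp only [norm_mul, norm_div, Complex.norm_real, Complex.norm_I, norm_neg, norm_one,
      Complex.norm_ofNat, Real.norm_eq_abs, abs_of_pos hL, mul_pow, sq_abs, div_pow]
    field_simp
  rw [show (fun n : ℤ => _) = _ from funext hco] at h
  have := fold_sum hL (b := fun n : ℤ => (∫ x in (0:ℝ)..L, f x * Real.sin (Real.pi * n / L * x)) ^ 2)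
    (by simp) (by
      intro n
      have : ∀ x : ℝ, f x * Real.sin (Real.pi * ((-n : ℤ) : ℝ) / L * x) =
        - (f x * Real.sin (Real.pi * n / L * x)) := by
        intro x
        rw [← mul_neg, ← Real.sin_neg]; congr 2; push_cast; ring
      simp only [this, intervalIntegral.integral_neg, neg_sq]) h
  simpa using this

lemma parseval_cos {L : ℝ} (hL : 0 < L) {f : ℝ → ℝ} (hf : Continuous f)
    (hf0 : ∫ x in (0:ℝ)..L, f x = 0) :
    HasSum (fun n : ℕ => 2 / L * (∫ x in (0:ℝ)..L, f x * Real.cos (Real.pi * (n + 1) / L * x)) ^ 2)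
      (∫ x in (0:ℝ)..L, f x ^ 2) := by
  have h := parExt_parseval (σ := 1) hL (by norm_num) hf
  have hco : ∀ n : ℤ, ‖(1 / (2 * L) : ℂ) * ∫ x in (0:ℝ)..L,
      (f x : ℂ) * (Complex.exp (-(Real.pi * n / L * x : ℝ) * Complex.I)
        + (1 : ℝ) * Complex.exp ((Real.pi * n / L * x : ℝ) * Complex.I))‖ ^ 2 =
        1 / L ^ 2 * (∫ x in (0:ℝ)..L, f x * Real.cos (Real.pi * n / L * x)) ^ 2 := by
    intro n
    have h1 : ∀ x : ℝ, (f x : ℂ) * (Complex.exp (-(Real.pi * n / L * x : ℝ) * Complex.I)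
        + (1 : ℝ) * Complex.exp ((Real.pi * n / L * x : ℝ) * Complex.I)) =
        2 * ((f x * Real.cos (Real.pi * n / L * x) : ℝ) : ℂ) := by
      intro x
      generalize Real.pi * n / L * x = z
      push_cast
      rw [Complex.cos, div_eq_mul_inv]
      ring
    simp only [h1]
    rw [intervalIntegral.integral_const_mul, intervalIntegral.integral_ofReal]
    simp only [norm_mul, norm_div, Complex.norm_real, norm_one,
      Complex.norm_ofNat, Real.norm_eq_abs, abs_of_pos hL, mul_pow, sq_abs, div_pow]
    field_simp
  rw [show (fun n : ℤ => _) = _ from funext hco] at h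
  have := fold_sum hL (b := fun n : ℤ => (∫ x in (0:ℝ)..L, f x * Real.cos (Real.pi * n / L * x)) ^ 2)
    (by simpa using hf0) (by
      intro n
      have : ∀ x : ℝ, f x * Real.cos (Real.pi * ((-n : ℤ) : ℝ) / L * x) =
        (f x * Real.cos (Real.pi * n / L * x)) := by
        intro x
        rw [← Real.cos_neg]; congr 2; push_cast; ring
      simp only [this]) h
  simpa using this

/-- joint smoothness -/
def SmF (f : ℝ → ℝ → ℝ) : Prop := ContDiff ℝ (⊤ : ℕ∞) (fun p : ℝ × ℝ => f p.1 p.2)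

lemma SmF.cont {f : ℝ → ℝ → ℝ} (hf : SmF f) : Continuous (fun p : ℝ × ℝ => f p.1 p.2) :=
  ContDiff.continuous hf

lemma SmF.hasX {f : ℝ → ℝ → ℝ} (hf : SmF f) (x t : ℝ) :
    HasDerivAt (fun y => f y t) (fderiv ℝ (fun p : ℝ × ℝ => f p.1 p.2) (x, t) (1, 0)) x := by
  have h1 : HasFDerivAt (fun p : ℝ × ℝ => f p.1 p.2) _ (x, t) :=
    (hf.differentiable (by simp) (x, t)).hasFDerivAt
  have h2 : HasDerivAt (fun y : ℝ => (y, t)) ((1 : ℝ), (0 : ℝ)) x :=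
    (hasDerivAt_id x).prodMk (hasDerivAt_const x t)
  exact h1.comp_hasDerivAt x h2

lemma SmF.hasT {f : ℝ → ℝ → ℝ} (hf : SmF f) (x t : ℝ) :
    HasDerivAt (fun s => f x s) (fderiv ℝ (fun p : ℝ × ℝ => f p.1 p.2) (x, t) (0, 1)) t := by
  have h1 : HasFDerivAt (fun p : ℝ × ℝ => f p.1 p.2) _ (x, t) :=
    (hf.differentiable (by simp) (x, t)).hasFDerivAt
  have h2 : HasDerivAt (fun s : ℝ => (x, s)) ((0 : ℝ), (1 : ℝ)) t :=
    (hasDerivAt_const t x).prodMk (hasDerivAt_id t)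
  exact h1.comp_hasDerivAt t h2

lemma SmF.pdX {f : ℝ → ℝ → ℝ} (hf : SmF f) : SmF (pdX f) := by
  have : (fun p : ℝ × ℝ => _root_.pdX f p.1 p.2) =
      fun p => fderiv ℝ (fun p : ℝ × ℝ => f p.1 p.2) p (1, 0) := by
    funext p; exact (hf.hasX p.1 p.2).deriv
  unfold SmF
  rw [this]
  exact (ContDiff.fderiv_right (m := (⊤ : ℕ∞)) hf (by simp)).clm_apply contDiff_const

lemma SmF.pdT {f : ℝ → ℝ → ℝ} (hf : SmF f) : SmF (pdT f) := by
  have : (fun p : ℝ × ℝ => _root_.pdT f p.1 p.2) =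
      fun p => fderiv ℝ (fun p : ℝ × ℝ => f p.1 p.2) p (0, 1) := by
    funext p; exact (hf.hasT p.1 p.2).deriv
  unfold SmF
  rw [this]
  exact (ContDiff.fderiv_right (m := (⊤ : ℕ∞)) hf (by simp)).clm_apply contDiff_const

lemma SmF.dX {f : ℝ → ℝ → ℝ} (hf : SmF f) (x t : ℝ) :
    HasDerivAt (fun y => f y t) (_root_.pdX f x t) x :=
  (hf.hasX x t).differentiableAt.hasDerivAt

lemma SmF.dT {f : ℝ → ℝ → ℝ} (hf : SmF f) (x t : ℝ) :
    HasDerivAt (fun s => f x s) (_root_.pdT f x t) t :=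
  (hf.hasT x t).differentiableAt.hasDerivAt

lemma SmF.cX {f : ℝ → ℝ → ℝ} (hf : SmF f) (t : ℝ) : Continuous (fun x => f x t) :=
  hf.cont.comp (by fun_prop : Continuous fun x : ℝ => (x, t))

lemma SmF.cT {f : ℝ → ℝ → ℝ} (hf : SmF f) (x : ℝ) : Continuous (fun t => f x t) :=
  hf.cont.comp (by fun_prop : Continuous fun t : ℝ => (x, t))

/-- sine coefficient -/
noncomputable def sinC (L k : ℝ) (f : ℝ → ℝ → ℝ) (t : ℝ) : ℝ :=
  ∫ x in (0:ℝ)..L, f x t * Real.sin (k * x)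

lemma sinC_hasDerivAt (L k : ℝ) {f : ℝ → ℝ → ℝ} (hf : SmF f) (t : ℝ) :
    HasDerivAt (sinC L k f) (sinC L k (pdT f) t) t := by
  have hc' := hf.pdT.cont
  have hcc : Continuous fun p : ℝ × ℝ => pdT f p.1 p.2 * Real.sin (k * p.1) := by fun_prop
  obtain ⟨B, hB⟩ := ((isCompact_uIcc (a := 0) (b := L)).prod
    (isCompact_Icc (a := t - 1) (b := t + 1))).exists_bound_of_continuousOn hcc.continuousOn
  have := intervalIntegral.hasDerivAt_integral_of_dominated_loc_of_deriv_le (μ := volume)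
    (a := 0) (b := L) (F := fun t x => f x t * Real.sin (k * x))
    (F' := fun t x => pdT f x t * Real.sin (k * x)) (x₀ := t) (s := Set.Icc (t - 1) (t + 1))
    (bound := fun _ => B) (Icc_mem_nhds (by linarith) (by linarith))
    (Filter.Eventually.of_forall fun s => by
      have := hf.cX s
      exact (by fun_prop : Continuous fun x => f x s * Real.sin (k * x)).aestronglyMeasurable)
    (by
      have := hf.cX t
      exact (by fun_prop : Continuous fun x => f x t * Real.sin (k * x)).intervalIntegrable _ _)
    (by
      have := hf.pdT.cX t
      exact (by fun_prop : Continuous fun x => pdT f x t * Real.sin (k * x)).aestronglyMeasurable)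
    (Filter.Eventually.of_forall fun x hx s hs => hB (x, s) ⟨Set.uIoc_subset_uIcc hx, hs⟩)
    (by simp)
    (Filter.Eventually.of_forall fun x hx s hs => (hf.dT x s).mul_const _)
  exact this.2

lemma sinC_continuous (L k : ℝ) {f : ℝ → ℝ → ℝ} (hf : SmF f) : Continuous (sinC L k f) :=
  continuous_iff_continuousAt.2 fun t => (sinC_hasDerivAt L k hf t).continuousAt

lemma ibp_cos {L k : ℝ} {g g' : ℝ → ℝ} (hg : ∀ x, HasDerivAt g (g' x) x) (hg' : Continuous g')
    (h0 : g 0 = 0) (hL : g L = 0) :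
    ∫ x in (0:ℝ)..L, g' x * Real.cos (k * x) = k * ∫ x in (0:ℝ)..L, g x * Real.sin (k * x) := by
  have hgc : Continuous g := continuous_iff_continuousAt.2 fun x => (hg x).continuousAt
  have hc : ∀ x, HasDerivAt (fun x => Real.cos (k * x)) (-Real.sin (k * x) * k) x := by
    intro x
    have := ((hasDerivAt_id x).const_mul k).cos
    simpa using this
  have h := intervalIntegral.integral_eq_sub_of_hasDerivAt (a := 0) (b := L)
    (fun x _ => (hg x).mul (hc x))
    ((by fun_prop : Continuous fun x => g' x * Real.cos (k * x) + g x * (-Real.sin (k * x) * k)).intervalIntegrable _ _)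
  simp only [Pi.mul_apply, h0, hL, zero_mul, sub_zero] at h
  rw [intervalIntegral.integral_add (Continuous.intervalIntegrable (by fun_prop) _ _)
    (Continuous.intervalIntegrable (by fun_prop) _ _)] at h
  rw [← intervalIntegral.integral_const_mul]
  have e : ∫ x in (0:ℝ)..L, g x * (-Real.sin (k * x) * k) =
      - ∫ x in (0:ℝ)..L, k * (g x * Real.sin (k * x)) := by
    rw [← intervalIntegral.integral_neg]; congr 1; funext x; ring
  linarith

lemma ibp_sin {L k : ℝ} (hk : Real.sin (k * L) = 0) {g g' : ℝ → ℝ}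
    (hg : ∀ x, HasDerivAt g (g' x) x) (hg' : Continuous g') :
    ∫ x in (0:ℝ)..L, g' x * Real.sin (k * x) = -k * ∫ x in (0:ℝ)..L, g x * Real.cos (k * x) := by
  have hgc : Continuous g := continuous_iff_continuousAt.2 fun x => (hg x).continuousAt
  have hc : ∀ x, HasDerivAt (fun x => Real.sin (k * x)) (Real.cos (k * x) * k) x := by
    intro x
    have := ((hasDerivAt_id x).const_mul k).sin
    simpa using this
  have h := intervalIntegral.integral_eq_sub_of_hasDerivAt (a := 0) (b := L)
    (fun x _ => (hg x).mul (hc x))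
    ((by fun_prop : Continuous fun x => g' x * Real.sin (k * x) + g x * (Real.cos (k * x) * k)).intervalIntegrable _ _)
  simp only [Pi.mul_apply, hk, mul_zero, Real.sin_zero, sub_zero] at h
  rw [intervalIntegral.integral_add (Continuous.intervalIntegrable (by fun_prop) _ _)
    (Continuous.intervalIntegrable (by fun_prop) _ _)] at h
  rw [← intervalIntegral.integral_const_mul]
  have e : ∫ x in (0:ℝ)..L, g x * (Real.cos (k * x) * k) =
      - ∫ x in (0:ℝ)..L, -k * (g x * Real.cos (k * x)) := by
    rw [← intervalIntegral.integral_neg]; congr 1; funext x; ring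
  linarith

lemma sinC_xx {L k : ℝ} (hk : Real.sin (k * L) = 0) {f : ℝ → ℝ → ℝ} (hf : SmF f) (t : ℝ)
    (h0 : f 0 t = 0) (hL : f L t = 0) :
    sinC L k (pdX (pdX f)) t = -k ^ 2 * sinC L k f t := by
  unfold sinC
  rw [ibp_sin hk (fun x => hf.pdX.dX x t) (hf.pdX.pdX.cX t),
    ibp_cos (fun x => hf.dX x t) (hf.pdX.cX t) h0 hL]
  ring

lemma cosC_x {L k : ℝ} {f : ℝ → ℝ → ℝ} (hf : SmF f) (t : ℝ)
    (h0 : f 0 t = 0) (hL : f L t = 0) :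
    ∫ x in (0:ℝ)..L, pdX f x t * Real.cos (k * x) = k * sinC L k f t :=
  ibp_cos (fun x => hf.dX x t) (hf.pdX.cX t) h0 hL

lemma deriv_zero_of_Ici {f f' : ℝ → ℝ} (hf : ∀ x, HasDerivAt f (f' x) x) (hf' : Continuous f')
    {c : ℝ} (h : ∀ t, c ≤ t → f t = 0) (t : ℝ) (ht : c ≤ t) : f' t = 0 := by
  have h1 : Set.EqOn f' (fun _ => 0) (Set.Ioi c) := by
    intro s hs
    have : f =ᶠ[nhds s] fun _ => 0 := by
      filter_upwards [Ioi_mem_nhds hs] with r hr using h r (le_of_lt hr)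
    exact (hf s).unique ((hasDerivAt_const s (0:ℝ)).congr_of_eventuallyEq this)
  have h2 := h1.closure hf' continuous_const
  rw [closure_Ioi] at h2
  exact h2 ht

lemma swap_int {L : ℝ} (hL : 0 < L) {g : ℝ → ℝ → ℝ} (hg : Continuous fun p : ℝ × ℝ => g p.1 p.2) :
    ∫ x in (0:ℝ)..L, ∫ ρ in (0:ℝ)..1, g x ρ = ∫ ρ in (0:ℝ)..1, ∫ x in (0:ℝ)..L, g x ρ := by
  simp only [integral_of_le hL.le, integral_of_le zero_le_one]
  apply MeasureTheory.integral_integral_swap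
  rw [Measure.prod_restrict]
  have : IntegrableOn (Function.uncurry g) (Set.Icc 0 L ×ˢ Set.Icc 0 1) (volume.prod volume) :=
    ContinuousOn.integrableOn_compact (isCompact_Icc.prod isCompact_Icc) hg.continuousOn
  exact this.mono_set (Set.prod_mono Set.Ioc_subset_Icc_self Set.Ioc_subset_Icc_self)

lemma hist_sum {F : ℕ → ℝ → ℝ} {g : ℝ → ℝ} (hF : ∀ n, Continuous (F n)) (hF0 : ∀ n x, 0 ≤ F n x)
    (hg : Continuous g) (h : ∀ ρ ∈ Set.Icc (0:ℝ) 1, HasSum (fun n => F n ρ) (g ρ)) :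
    HasSum (fun n => ∫ ρ in (0:ℝ)..1, F n ρ) (∫ ρ in (0:ℝ)..1, g ρ) := by
  have hsum : Summable fun n => ∫ ρ in (0:ℝ)..1, F n ρ := by
    apply summable_of_sum_range_le (c := ∫ ρ in (0:ℝ)..1, g ρ)
    · intro n; exact intervalIntegral.integral_nonneg zero_le_one fun x _ => hF0 n x
    · intro N
      rw [← intervalIntegral.integral_finset_sum fun n _ => (hF n).intervalIntegrable _ _]
      apply intervalIntegral.integral_mono_on zero_le_one
      · exact (continuous_finset_sum _ fun n _ => hF n).intervalIntegrable _ _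
      · exact hg.intervalIntegrable _ _
      · intro x hx
        exact sum_le_hasSum _ (fun n _ => hF0 n x) (h x hx)
  simp only [integral_of_le zero_le_one] at hsum ⊢
  have := hasSum_integral_of_summable_integral_norm (μ := volume.restrict (Set.Ioc (0:ℝ) 1)) (F := F)
    (fun n => ((hF n).integrableOn_Ioc)) (by
      simpa only [Real.norm_eq_abs, abs_of_nonneg (hF0 _ _)] using hsum)
  have e : ∫ ρ in Set.Ioc (0:ℝ) 1, ∑' n, F n ρ = ∫ ρ in Set.Ioc (0:ℝ) 1, g ρ :=
    setIntegral_congr_fun measurableSet_Ioc fun x hx => (h x (Set.Ioc_subset_Icc_self hx)).tsum_eq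
  rw [e] at this
  exact this

lemma ext_zero {L : ℝ} (hL : 0 < L) {g : ℝ → ℝ → ℝ} (hg : Continuous fun p : ℝ × ℝ => g p.1 p.2)
    (h : ∀ x ∈ Set.Ioo (0:ℝ) L, ∀ t > (0:ℝ), g x t = 0) :
    ∀ x ∈ Set.Icc (0:ℝ) L, ∀ t ≥ (0:ℝ), g x t = 0 := by
  have h1 : Set.EqOn (fun p : ℝ × ℝ => g p.1 p.2) (fun _ => 0) (Set.Ioo (0:ℝ) L ×ˢ Set.Ioi (0:ℝ)) :=
    fun p hp => h p.1 hp.1 p.2 hp.2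
  have h2 := h1.closure hg continuous_const
  rw [closure_prod_eq, closure_Ioo hL.ne, closure_Ioi] at h2
  intro x hx t ht
  exact h2 (show (x, t) ∈ _ from ⟨hx, ht⟩)

section modes
variable {L τ a κ : ℝ} {u θ : ℝ → ℝ → ℝ}

lemma sol_pde_u (hL : 0 < L) (h : IsSmoothSolDHBeam0 L τ a κ u θ) :
    ∀ x ∈ Set.Icc (0:ℝ) L, ∀ t ≥ (0:ℝ),
      pdT (pdT u) x t = -pdX (pdX (pdX (pdX u))) x t + θ x t := by
  have su : SmF u := h.smooth_u
  have sθ : SmF θ := h.smooth_θ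
  have c1 := su.pdT.pdT.cont
  have c2 := su.pdX.pdX.pdX.pdX.cont
  have c3 := sθ.cont
  intro x hx t ht
  have := ext_zero hL (g := fun x t => pdT (pdT u) x t + pdX (pdX (pdX (pdX u))) x t - θ x t)
    ((c1.add c2).sub c3) h.pde_u x hx t ht
  linarith

lemma sol_pde_θ (hL : 0 < L) (h : IsSmoothSolDHBeam0 L τ a κ u θ) :
    ∀ x ∈ Set.Icc (0:ℝ) L, ∀ t ≥ (0:ℝ),
      pdT θ x t = κ * pdX (pdX θ) x (t - τ) + a * pdX (pdX θ) x t - pdT u x t := by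
  have su : SmF u := h.smooth_u
  have sθ : SmF θ := h.smooth_θ
  have c1 := sθ.pdT.cont
  have c2 := sθ.pdX.pdX.cont
  have c4 : Continuous fun p : ℝ × ℝ => pdX (pdX θ) p.1 (p.2 - τ) :=
    c2.comp (by fun_prop : Continuous fun p : ℝ × ℝ => (p.1, p.2 - τ))
  have c3 := su.pdT.cont
  intro x hx t ht
  have := ext_zero hL (g := fun x t => pdT θ x t - κ * pdX (pdX θ) x (t - τ)
      - a * pdX (pdX θ) x t + pdT u x t)
    (((c1.sub (c4.const_mul κ)).sub (c2.const_mul a)).add c3) h.pde_θ x hx t ht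
  linarith

lemma rhs_u_coef {k : ℝ} (hk : Real.sin (k * L) = 0)
    (h : IsSmoothSolDHBeam0 L τ a κ u θ) {t : ℝ} (ht : 0 ≤ t) :
    ∫ x in (0:ℝ)..L, (-pdX (pdX (pdX (pdX u))) x t + θ x t) * Real.sin (k * x)
      = -(k ^ 2) ^ 2 * sinC L k u t + sinC L k θ t := by
  have su : SmF u := h.smooth_u
  have sθ : SmF θ := h.smooth_θ
  have c2 := su.pdX.pdX.pdX.pdX.cX t
  have c3 := sθ.cX t
  obtain ⟨b1, b2, b3, b4⟩ := h.bc_u t ht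
  have e1 := sinC_xx hk su.pdX.pdX t b3 b4
  have e2 := sinC_xx hk su t b1 b2
  rw [e2] at e1
  have : ∫ x in (0:ℝ)..L, (-pdX (pdX (pdX (pdX u))) x t + θ x t) * Real.sin (k * x)
      = -sinC L k (pdX (pdX (pdX (pdX u)))) t + sinC L k θ t := by
    unfold sinC
    rw [← intervalIntegral.integral_neg, ← intervalIntegral.integral_add
      (Continuous.intervalIntegrable (by fun_prop) _ _)
      (Continuous.intervalIntegrable (by fun_prop) _ _)]
    congr 1; funext x; ring
  rw [this, e1]; ring

lemma rhs_θ_coef {k : ℝ} (hτ : 0 < τ) (hk : Real.sin (k * L) = 0)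
    (h : IsSmoothSolDHBeam0 L τ a κ u θ) {t : ℝ} (ht : 0 ≤ t) :
    ∫ x in (0:ℝ)..L, (κ * pdX (pdX θ) x (t - τ) + a * pdX (pdX θ) x t - pdT u x t)
        * Real.sin (k * x)
      = -κ * k ^ 2 * sinC L k θ (t - τ) - a * k ^ 2 * sinC L k θ t - sinC L k (pdT u) t := by
  have su : SmF u := h.smooth_u
  have sθ : SmF θ := h.smooth_θ
  have c2 := sθ.pdX.pdX.cX t
  have c2' := sθ.pdX.pdX.cX (t - τ)
  have c3 := su.pdT.cX t
  obtain ⟨b1, b2⟩ := h.bc_θ t (by linarith)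
  obtain ⟨b3, b4⟩ := h.bc_θ (t - τ) (by linarith)
  have e1 := sinC_xx hk sθ t b1 b2
  have e2 := sinC_xx hk sθ (t - τ) b3 b4
  have : ∫ x in (0:ℝ)..L, (κ * pdX (pdX θ) x (t - τ) + a * pdX (pdX θ) x t - pdT u x t)
        * Real.sin (k * x)
      = κ * sinC L k (pdX (pdX θ)) (t - τ) + a * sinC L k (pdX (pdX θ)) t
        - sinC L k (pdT u) t := by
    unfold sinC
    rw [← intervalIntegral.integral_const_mul, ← intervalIntegral.integral_const_mul,
      ← intervalIntegral.integral_add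
      (Continuous.intervalIntegrable (by fun_prop) _ _)
      (Continuous.intervalIntegrable (by fun_prop) _ _),
      ← intervalIntegral.integral_sub
      (Continuous.intervalIntegrable (by fun_prop) _ _)
      (Continuous.intervalIntegrable (by fun_prop) _ _)]
    congr 1; funext x; ring
  rw [this, e1, e2]; ring

lemma sinC_utt {k : ℝ} (hL : 0 < L) (hk : Real.sin (k * L) = 0)
    (h : IsSmoothSolDHBeam0 L τ a κ u θ) {t : ℝ} (ht : 0 ≤ t) :
    sinC L k (pdT (pdT u)) t = -(k ^ 2) ^ 2 * sinC L k u t + sinC L k θ t := by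
  rw [← rhs_u_coef hk h ht]
  unfold sinC
  apply intervalIntegral.integral_congr
  intro x hx
  rw [Set.uIcc_of_le hL.le] at hx
  simp only [sol_pde_u hL h x hx t ht]

lemma sinC_θt {k : ℝ} (hL : 0 < L) (hτ : 0 < τ) (hk : Real.sin (k * L) = 0)
    (h : IsSmoothSolDHBeam0 L τ a κ u θ) {t : ℝ} (ht : 0 ≤ t) :
    sinC L k (pdT θ) t
      = -κ * k ^ 2 * sinC L k θ (t - τ) - a * k ^ 2 * sinC L k θ t - sinC L k (pdT u) t := by
  rw [← rhs_θ_coef hτ hk h ht]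
  unfold sinC
  apply intervalIntegral.integral_congr
  intro x hx
  rw [Set.uIcc_of_le hL.le] at hx
  simp only [sol_pde_θ hL h x hx t ht]

lemma modeSol_first {k : ℝ} (hL : 0 < L) (hτ : 0 < τ) (hk : Real.sin (k * L) = 0)
    (h : IsSmoothSolDHBeam0 L τ a κ u θ) :
    ModeSol τ a κ (k ^ 2) (sinC L k u) (sinC L k (pdT u)) (sinC L k θ) := by
  have su : SmF u := h.smooth_u
  have sθ : SmF θ := h.smooth_θ
  refine ⟨sinC_continuous L k su, sinC_continuous L k su.pdT, sinC_continuous L k sθ,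
    fun t _ => sinC_hasDerivAt L k su t, fun t ht => ?_, fun t ht => ?_⟩
  · rw [← sinC_utt hL hk h (le_of_lt ht)]; exact sinC_hasDerivAt L k su.pdT t
  · rw [← sinC_θt hL hτ hk h (le_of_lt ht)]; exact sinC_hasDerivAt L k sθ t

lemma modeSol_second {k : ℝ} (hL : 0 < L) (hτ : 0 < τ) (hk : Real.sin (k * L) = 0)
    (h : IsSmoothSolDHBeam0 L τ a κ u θ) :
    ModeSol τ a κ (k ^ 2) (sinC L k (pdT u))
      (fun t => -(k ^ 2) ^ 2 * sinC L k u t + sinC L k θ t) (sinC L k (pdT θ)) := by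
  have su : SmF u := h.smooth_u
  have sθ : SmF θ := h.smooth_θ
  refine ⟨sinC_continuous L k su.pdT,
    ((sinC_continuous L k su).const_mul _).add (sinC_continuous L k sθ),
    sinC_continuous L k sθ.pdT, fun t ht => ?_, fun t ht => ?_, fun t ht => ?_⟩
  · rw [← sinC_utt hL hk h (le_of_lt ht)]; exact sinC_hasDerivAt L k su.pdT t
  · exact ((sinC_hasDerivAt L k su t).const_mul _).add (sinC_hasDerivAt L k sθ t)
  · have e : sinC L k (pdT θ) =ᶠ[nhds t] fun t => -κ * k ^ 2 * sinC L k θ (t - τ)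
        - a * k ^ 2 * sinC L k θ t - sinC L k (pdT u) t := by
      filter_upwards [Ioi_mem_nhds ht] with s hs using sinC_θt hL hτ hk h (le_of_lt hs)
    rw [← sinC_utt hL hk h (le_of_lt ht)]
    have d1 : HasDerivAt (fun t => sinC L k θ (t - τ)) (sinC L k (pdT θ) (t - τ)) t :=
      HasDerivAt.comp_sub_const t τ (sinC_hasDerivAt L k sθ (t - τ))
    exact (((d1.const_mul (-κ * k ^ 2)).sub
      ((sinC_hasDerivAt L k sθ t).const_mul (a * k ^ 2))).sub
      (sinC_hasDerivAt L k su.pdT t)).congr_of_eventuallyEq e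

end modes

lemma hist_hasSum {L τ t : ℝ} (hL : 0 < L) (hτ : 0 < τ) (ht : 0 ≤ t) {f : ℝ → ℝ → ℝ} (hf : SmF f)
    (h0 : ∀ s, -τ ≤ s → f 0 s = 0 ∧ f L s = 0) :
    HasSum (fun n : ℕ => 2 / L * ((Real.pi * (n + 1) / L) ^ 2
        * ∫ ρ in (0:ℝ)..1, sinC L (Real.pi * (n + 1) / L) f (t - τ * ρ) ^ 2))
      (∫ x in (0:ℝ)..L, ∫ ρ in (0:ℝ)..1, (pdX f x (t - τ * ρ)) ^ 2) := by
  have hc : Continuous fun p : ℝ × ℝ => (pdX f p.1 (t - τ * p.2)) ^ 2 :=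
    (hf.pdX.cont.comp (by fun_prop : Continuous fun p : ℝ × ℝ => (p.1, t - τ * p.2))).pow 2
  rw [swap_int hL (g := fun x ρ => (pdX f x (t - τ * ρ)) ^ 2) hc]
  have hs := hist_sum (F := fun n ρ => 2 / L * ((Real.pi * (n + 1) / L) ^ 2
        * sinC L (Real.pi * (n + 1) / L) f (t - τ * ρ) ^ 2))
    (g := fun ρ => ∫ x in (0:ℝ)..L, (pdX f x (t - τ * ρ)) ^ 2)
    (fun n => by
      have := sinC_continuous L (Real.pi * (n + 1) / L) hf
      fun_prop)
    (fun n x => by positivity)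
    (intervalIntegral.continuous_parametric_intervalIntegral_of_continuous'
      (f := fun ρ x => (pdX f x (t - τ * ρ)) ^ 2)
      (hc.comp (by fun_prop : Continuous fun p : ℝ × ℝ => (p.2, p.1))) 0 L)
    (by
      intro ρ hρ
      have hs : -τ ≤ t - τ * ρ := by nlinarith [hρ.2]
      obtain ⟨b0, b1⟩ := h0 _ hs
      have hz : ∫ x in (0:ℝ)..L, pdX f x (t - τ * ρ) = 0 := by
        rw [intervalIntegral.integral_eq_sub_of_hasDerivAt (fun x _ => hf.dX x _)
          ((hf.pdX.cX _).intervalIntegrable _ _), b0, b1, sub_zero]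
      have := parseval_cos hL (hf.pdX.cX (t - τ * ρ)) hz
      simp only [cosC_x hf (t - τ * ρ) b0 b1, mul_pow] at this
      exact this)
  simpa only [intervalIntegral.integral_const_mul] using hs

lemma freq_sin {L : ℝ} (hL : 0 < L) (n : ℕ) :
    Real.sin (Real.pi * (n + 1) / L * L) = 0 := by
  have : Real.pi * (n + 1) / L * L = ((n + 1 : ℕ) : ℝ) * Real.pi := by
    push_cast; field_simp
  rw [this, Real.sin_nat_mul_pi]

lemma energy_hasSum {L τ a κ ξ t : ℝ} {u θ : ℝ → ℝ → ℝ} (hL : 0 < L) (hτ : 0 < τ) (ht : 0 ≤ t)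
    (h : IsSmoothSolDHBeam0 L τ a κ u θ) :
    HasSum (fun n : ℕ => 2 / L * modeE τ ξ ((Real.pi * (n + 1) / L) ^ 2)
        (sinC L (Real.pi * (n + 1) / L) u) (sinC L (Real.pi * (n + 1) / L) (pdT u))
        (sinC L (Real.pi * (n + 1) / L) θ) t)
      (2 * energyDHBeam L τ ξ u θ t) := by
  have su : SmF u := h.smooth_u
  have sθ : SmF θ := h.smooth_θ
  obtain ⟨b1, b2, b3, b4⟩ := h.bc_u t ht
  have p1 := parseval_sin hL (su.pdT.cX t)
  have p2 := parseval_sin hL (su.pdX.pdX.cX t)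
  have p3 := parseval_sin hL (sθ.cX t)
  have p4 := (hist_hasSum hL hτ ht sθ h.bc_θ).mul_left ξ
  have hsum := ((p1.add p2).add p3).add p4
  have c1 := su.pdT.cX t
  have c2 := su.pdX.pdX.cX t
  have c3 := sθ.cX t
  have eE : 2 * energyDHBeam L τ ξ u θ t = (∫ x in (0:ℝ)..L, pdT u x t ^ 2)
      + (∫ x in (0:ℝ)..L, pdX (pdX u) x t ^ 2) + (∫ x in (0:ℝ)..L, θ x t ^ 2)
      + ξ * ∫ x in (0:ℝ)..L, ∫ ρ in (0:ℝ)..1, (pdX θ x (t - τ * ρ)) ^ 2 := by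
    unfold energyDHBeam
    rw [intervalIntegral.integral_add (Continuous.intervalIntegrable (by fun_prop) _ _)
      (Continuous.intervalIntegrable (by fun_prop) _ _),
      intervalIntegral.integral_add (Continuous.intervalIntegrable (by fun_prop) _ _)
      (Continuous.intervalIntegrable (by fun_prop) _ _)]
    ring
  rw [eE]
  convert hsum using 1
  funext n
  have e2 := sinC_xx (freq_sin hL n) su t b1 b2
  unfold modeE
  change _ = 2 / L * (sinC L (Real.pi * (n + 1) / L) (pdT u) t) ^ 2
    + 2 / L * (sinC L (Real.pi * (n + 1) / L) (pdX (pdX u)) t) ^ 2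
    + 2 / L * (sinC L (Real.pi * (n + 1) / L) θ t) ^ 2 + _
  rw [e2]
  ring

lemma graph_hasSum {L τ a κ ξ : ℝ} {u θ : ℝ → ℝ → ℝ} (hL : 0 < L) (hτ : 0 < τ)
    (h : IsSmoothSolDHBeam0 L τ a κ u θ) :
    HasSum (fun n : ℕ => 2 / L * modeE τ ξ ((Real.pi * (n + 1) / L) ^ 2)
        (sinC L (Real.pi * (n + 1) / L) (pdT u))
        (fun t => -((Real.pi * (n + 1) / L) ^ 2) ^ 2 * sinC L (Real.pi * (n + 1) / L) u t
          + sinC L (Real.pi * (n + 1) / L) θ t)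
        (sinC L (Real.pi * (n + 1) / L) (pdT θ)) 0)
      (graphNormSqDHBeam0 L τ a κ ξ u θ) := by
  have su : SmF u := h.smooth_u
  have sθ : SmF θ := h.smooth_θ
  have b1 : pdT u 0 0 = 0 := deriv_zero_of_Ici (fun s => su.dT 0 s) (su.pdT.cT 0) (c := 0)
    (fun t ht => (h.bc_u t ht).1) 0 le_rfl
  have b2 : pdT u L 0 = 0 := deriv_zero_of_Ici (fun s => su.dT L s) (su.pdT.cT L) (c := 0)
    (fun t ht => (h.bc_u t ht).2.1) 0 le_rfl
  have bθ : ∀ s, -τ ≤ s → pdT θ 0 s = 0 ∧ pdT θ L s = 0 := fun s hs =>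
    ⟨deriv_zero_of_Ici (fun s => sθ.dT 0 s) (sθ.pdT.cT 0) (c := -τ)
      (fun t ht => (h.bc_θ t ht).1) s hs,
     deriv_zero_of_Ici (fun s => sθ.dT L s) (sθ.pdT.cT L) (c := -τ)
      (fun t ht => (h.bc_θ t ht).2) s hs⟩
  have c1 := su.pdX.pdX.pdX.pdX.cX 0
  have c2 := sθ.cX 0
  have c3 := sθ.pdX.pdX.cX 0
  have c4 := sθ.pdX.pdX.cX (0 - τ)
  have c5 := su.pdT.cX 0
  have p1 := parseval_sin hL (su.pdT.pdX.pdX.cX 0)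
  have p2 := parseval_sin hL
    (by fun_prop : Continuous fun x => -pdX (pdX (pdX (pdX u))) x 0 + θ x 0)
  have p3 := parseval_sin hL
    (by fun_prop : Continuous fun x =>
      κ * pdX (pdX θ) x (0 - τ) + a * pdX (pdX θ) x 0 - pdT u x 0)
  have p4 := (hist_hasSum hL hτ le_rfl sθ.pdT bθ).mul_left ξ
  have hsum := ((p1.add p2).add p3).add p4
  have eE : graphNormSqDHBeam0 L τ a κ ξ u θ = (∫ x in (0:ℝ)..L, pdX (pdX (pdT u)) x 0 ^ 2)
      + (∫ x in (0:ℝ)..L, (-pdX (pdX (pdX (pdX u))) x 0 + θ x 0) ^ 2)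
      + (∫ x in (0:ℝ)..L,
        (κ * pdX (pdX θ) x (0 - τ) + a * pdX (pdX θ) x 0 - pdT u x 0) ^ 2)
      + ξ * ∫ x in (0:ℝ)..L, ∫ ρ in (0:ℝ)..1, (pdX (pdT θ) x (0 - τ * ρ)) ^ 2 := by
    unfold graphNormSqDHBeam0
    simp only [zero_sub, neg_mul]
  rw [eE]
  convert hsum using 1
  funext n
  have e1 := sinC_xx (freq_sin hL n) su.pdT 0 b1 b2
  have e2 := rhs_u_coef (freq_sin hL n) h (le_refl (0:ℝ))
  have e3 := rhs_θ_coef hτ (freq_sin hL n) h (le_refl (0:ℝ))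
  rw [← sinC_θt hL hτ (freq_sin hL n) h (le_refl (0:ℝ))] at e3
  rw [e2, e3]
  unfold modeE
  change _ = 2 / L * (sinC L (Real.pi * (n + 1) / L) (pdX (pdX (pdT u))) 0) ^ 2
    + _ + _ + _
  rw [e1]
  ring

/-- Polynomial stability of order `1` for the thermoelastic beam with delayed heat
conduction and zero-order coupling, for `0 < κ < a` and `ξ` in the interior of
`J_{a,κ,τ}`. -/
theorem polynomial_stability_DHbeam0
    (L τ a κ ξ : ℝ) (hL : 0 < L) (hτ : 0 < τ) (hκ : 0 < κ) (hκa : κ < a)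
    (hξ₁ : τ * (a - Real.sqrt (a ^ 2 - κ ^ 2)) < ξ)
    (hξ₂ : ξ < τ * (a + Real.sqrt (a ^ 2 - κ ^ 2))) :
    ∃ C > (0 : ℝ), ∀ u θ : ℝ → ℝ → ℝ,
      IsSmoothSolDHBeam0 L τ a κ u θ →
      ∀ t > (0 : ℝ),
        energyDHBeam L τ ξ u θ t ≤
          (C / t ^ 2) * (energyDHBeam L τ ξ u θ 0 + graphNormSqDHBeam0 L τ a κ ξ u θ) := by
  have hs0 := Real.sqrt_nonneg (a ^ 2 - κ ^ 2)
  have hs2 : Real.sqrt (a ^ 2 - κ ^ 2) ^ 2 = a ^ 2 - κ ^ 2 := Real.sq_sqrt (by nlinarith)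
  set s := Real.sqrt (a ^ 2 - κ ^ 2) with hs
  have hsa : s < a := by nlinarith
  have hη1 : a - s < ξ / τ := by rw [lt_div_iff₀ hτ]; linarith
  have hη2 : ξ / τ < a + s := by rw [div_lt_iff₀ hτ]; linarith
  have hξ : 0 < ξ := lt_of_le_of_lt (mul_nonneg hτ.le (by linarith)) hξ₁
  have hA : 0 < 2 * a - ξ / τ := by linarith
  have hd : κ ^ 2 < (2 * a - ξ / τ) * (ξ / τ) := by nlinarith
  obtain ⟨C, hC, H⟩ := mode_decay (m := (Real.pi / L) ^ 2) hτ hκ hκa hξ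
    (by have := Real.pi_pos; positivity) hA hd
  refine ⟨C, hC, fun u θ h t ht => ?_⟩
  have S1 := energy_hasSum (ξ := ξ) hL hτ ht.le h
  have S0 := energy_hasSum (ξ := ξ) hL hτ le_rfl h
  have SQ := graph_hasSum (ξ := ξ) hL hτ h
  have hQ : 0 ≤ graphNormSqDHBeam0 L τ a κ ξ u θ := by
    refine SQ.nonneg fun n => ?_
    unfold modeE
    have := hist_nonneg τ (sinC L (Real.pi * (n + 1) / L) (pdT θ)) 0
    positivity
  have key := hasSum_le (fun n => ?_) S1 ((S0.add SQ).mul_left (C / t ^ 2))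
  · have hCt : 0 ≤ C / t ^ 2 := by positivity
    nlinarith [mul_nonneg hCt hQ]
  · have hm : (Real.pi / L) ^ 2 ≤ (Real.pi * (n + 1) / L) ^ 2 := by
      have := Real.pi_pos
      apply pow_le_pow_left₀ (by positivity)
      apply div_le_div_of_nonneg_right _ hL.le
      nlinarith [(Nat.cast_nonneg n : (0:ℝ) ≤ n)]
    have hk := freq_sin hL n
    have := H _ hm _ _ _ _ _ (modeSol_first hL hτ hk h) (modeSol_second hL hτ hk h)
      (fun t _ => rfl) t ht
    have h2 := mul_le_mul_of_nonneg_left this (by positivity : 0 ≤ 2 / L)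
    refine h2.trans (le_of_eq ?_)
    ring
end

section
/- Fix real numbers τ > 0, a > 0, ξ > 0, and let (u,θ) be a smooth solution of the delayed thermoelastic plate with Kelvin–Voigt damping on a bounded open set Ω ⊂ ℝⁿ. Then for every t > 0, the energy satisfies E′(t) ≤ −(a/2)·∫_Ω (Δu_t(x,t))² dx + (1/a + ξ/(2τ))·∫_Ω (Δu(x,t))² dx − ∫_Ω |∇θ(x,t)|² dx + (1/a − ξ/(2τ))·∫_Ω (Δu(x,t−τ))² dx. -/
open MeasureTheory

/-- The Laplacian of a real-valued function on `ℝⁿ` (as a sum of second partial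
derivatives along the coordinate directions). -/
noncomputable def lapl (n : ℕ) (f : EuclideanSpace ℝ (Fin n) → ℝ)
    (x : EuclideanSpace ℝ (Fin n)) : ℝ :=
  ∑ i : Fin n, fderiv ℝ (fun y => fderiv ℝ f y (EuclideanSpace.single i 1)) x
    (EuclideanSpace.single i 1)

/-- The squared norm of the spatial gradient of a real-valued function on `ℝⁿ`. -/
noncomputable def gradNormSq (n : ℕ) (f : EuclideanSpace ℝ (Fin n) → ℝ)
    (x : EuclideanSpace ℝ (Fin n)) : ℝ :=
  ∑ i : Fin n, (fderiv ℝ f x (EuclideanSpace.single i 1)) ^ 2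

/-- A smooth solution of the delayed thermoelastic plate with Kelvin–Voigt damping:
`u_tt + Δ²u(·,·−τ) + a·Δ²u_t + Δθ = 0`, `θ_t − Δθ − Δu_t = 0` on `Ω×(0,∞)`,
with boundary conditions `u = Δu = 0` and `θ = 0` on `∂Ω`. -/
structure IsSmoothSolKVPlate (n : ℕ) (Ω : Set (EuclideanSpace ℝ (Fin n))) (τ a : ℝ)
    (u θ : EuclideanSpace ℝ (Fin n) → ℝ → ℝ) : Prop where
  smooth_u : ContDiff ℝ (⊤ : ℕ∞) (fun p : EuclideanSpace ℝ (Fin n) × ℝ => u p.1 p.2)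
  smooth_θ : ContDiff ℝ (⊤ : ℕ∞) (fun p : EuclideanSpace ℝ (Fin n) × ℝ => θ p.1 p.2)
  pde_u : ∀ x ∈ Ω, ∀ t > (0 : ℝ),
    deriv (deriv (u x)) t
      + lapl n (fun y => lapl n (fun z => u z (t - τ)) y) x
      + a * lapl n (fun y => lapl n (fun z => deriv (u z) t) y) x
      + lapl n (fun y => θ y t) x = 0
  pde_θ : ∀ x ∈ Ω, ∀ t > (0 : ℝ),
    deriv (θ x) t - lapl n (fun y => θ y t) x - lapl n (fun y => deriv (u y) t) x = 0
  bc_u : ∀ x ∈ frontier Ω, ∀ t : ℝ, -τ ≤ t → u x t = 0 ∧ lapl n (fun y => u y t) x = 0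
  bc_θ : ∀ x ∈ frontier Ω, ∀ t : ℝ, 0 ≤ t → θ x t = 0

/-- The energy of the delayed thermoelastic plate with Kelvin–Voigt damping. -/
noncomputable def energyKVPlate (n : ℕ) (Ω : Set (EuclideanSpace ℝ (Fin n))) (τ ξ : ℝ)
    (u θ : EuclideanSpace ℝ (Fin n) → ℝ → ℝ) (t : ℝ) : ℝ :=
  (1 / 2) * ((∫ x in Ω, ((deriv (u x) t) ^ 2 + (lapl n (fun y => u y t) x) ^ 2
      + (θ x t) ^ 2))
    + ξ * ∫ x in Ω, ∫ ρ in (0 : ℝ)..(1 : ℝ), (lapl n (fun y => u y (t - τ * ρ)) x) ^ 2)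

section KV
open Set Filter Topology

theorem kv_hasDerivAt_zero {h : ℝ → ℝ} (h0 : h 0 = 0)
    (hd : DifferentiableAt ℝ (fun t => |h t|) 0) : HasDerivAt h 0 0 := by
  have hmin : IsLocalMin (fun t => |h t|) 0 :=
    Filter.Eventually.of_forall fun t => by simp [h0]
  have h1 := hd.hasDerivAt
  rw [hmin.deriv_eq_zero] at h1
  rw [hasDerivAt_iff_isLittleO_nhds_zero] at h1 ⊢
  simp only [zero_add, h0, abs_zero, sub_zero, smul_zero] at h1 ⊢
  exact (Asymptotics.isLittleO_abs_left).1 h1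

theorem kv_exists_frontier {E : Type*} [NormedAddCommGroup E] [NormedSpace ℝ E]
    {Ω : Set E} {x y : E} (hx : x ∈ Ω) (hy : y ∉ Ω) :
    ∃ z ∈ segment ℝ x y, z ∈ frontier Ω := by
  by_contra! hc
  have hpre : IsPreconnected (segment ℝ x y) := (convex_segment x y).isPreconnected
  have h1 : segment ℝ x y ⊆ interior Ω ∪ (closure Ω)ᶜ := by
    intro z hz
    by_cases h : z ∈ closure Ω
    · left
      by_contra h2
      exact hc z hz ⟨h, h2⟩
    · exact Or.inr h
  have h2 : x ∈ interior Ω := by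
    by_contra h2
    exact hc x (left_mem_segment ℝ x y) ⟨subset_closure hx, h2⟩
  have h3 : y ∈ (closure Ω)ᶜ := by
    intro h
    exact hc y (right_mem_segment ℝ x y) ⟨h, fun h2 => hy (interior_subset h2)⟩
  obtain ⟨z, -, hz1, hz2⟩ := hpre (interior Ω) (closure Ω)ᶜ isOpen_interior
    isClosed_closure.isOpen_compl h1 ⟨x, left_mem_segment ℝ x y, h2⟩
    ⟨y, right_mem_segment ℝ x y, h3⟩
  exact hz2 (subset_closure (interior_subset hz1))

theorem kv_lipschitz_indicator {E : Type*} [NormedAddCommGroup E] [NormedSpace ℝ E]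
    {Ω : Set E} {F : E → ℝ} {C : NNReal} (hF : LipschitzWith C F)
    (h0 : ∀ x ∈ frontier Ω, F x = 0) : LipschitzWith C (Ω.indicator F) := by
  have key : ∀ x y, x ∈ Ω → y ∉ Ω → |F x| ≤ C * dist x y := by
    intro x y hx hy
    obtain ⟨z, hz, hzf⟩ := kv_exists_frontier hx hy
    have h1 := hF.dist_le_mul x z
    rw [Real.dist_eq, h0 z hzf, sub_zero] at h1
    have h2 := dist_add_dist_of_mem_segment hz
    have h3 : (0 : ℝ) ≤ C := C.2
    have h4 : dist x z ≤ dist x y := by linarith [dist_nonneg (x := z) (y := y)]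
    exact h1.trans (mul_le_mul_of_nonneg_left h4 h3)
  refine LipschitzWith.of_dist_le_mul fun x y => ?_
  by_cases hx : x ∈ Ω <;> by_cases hy : y ∈ Ω
  · simpa [hx, hy] using hF.dist_le_mul x y
  · simpa [hx, hy, Real.dist_eq] using key x y hx hy
  · simpa [hx, hy, Real.dist_eq, dist_comm] using key y x hy hx
  · simp [hx, hy]; positivity

theorem kv_integral_fderiv_eq_zero {E : Type*} [NormedAddCommGroup E] [InnerProductSpace ℝ E]
    [FiniteDimensional ℝ E] [MeasurableSpace E] [BorelSpace E]
    {Ω : Set E} (hΩ : IsOpen Ω) (hb : Bornology.IsBounded Ω) {F : E → ℝ}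
    (hF : ContDiff ℝ 1 F) (h0 : ∀ x ∈ frontier Ω, F x = 0) (v : E) :
    ∫ x in Ω, fderiv ℝ F x v = 0 := by
  obtain ⟨R, hR0, hR⟩ := hb.subset_ball_lt 0 0
  let χ : ContDiffBump (0 : E) := ⟨R, R + 1, hR0, by linarith⟩
  have hχ1 : ∀ x ∈ Ω, (χ : E → ℝ) =ᶠ[𝓝 x] 1 := fun x hx =>
    χ.eventuallyEq_one_of_mem_ball (hR hx)
  obtain ⟨D, hD⟩ := ContDiff.lipschitzWith_of_hasCompactSupport (𝕂 := ℝ) (n := 1)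
    χ.hasCompactSupport χ.contDiff (by simp)
  obtain ⟨C, hC⟩ := ContDiff.lipschitzWith_of_hasCompactSupport (𝕂 := ℝ) (n := 1)
    (f := fun x => χ x * F x) χ.hasCompactSupport.mul_right (χ.contDiff.mul hF) (by simp)
  set H : E → ℝ := Ω.indicator (fun x => χ x * F x) with hH
  have hHl : LipschitzWith C H :=
    kv_lipschitz_indicator hC (fun x hx => by simp [h0 x hx])
  have hHabs : LipschitzWith C (fun x => |H x|) := by
    refine LipschitzWith.of_dist_le_mul fun x y => ?_
    refine le_trans ?_ (hHl.dist_le_mul x y)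
    rw [Real.dist_eq, Real.dist_eq]
    exact abs_abs_sub_abs_le_abs_sub _ _
  have key := hHl.integral_lineDeriv_mul_eq (μ := volume) hD χ.hasCompactSupport v
  have hr : ∫ x, lineDeriv ℝ χ x (-v) * H x = 0 := by
    rw [← integral_zero E ℝ (μ := volume)]
    congr 1
    ext x
    by_cases hx : x ∈ Ω
    · rw [(hχ1 x hx).lineDeriv_eq]
      have : lineDeriv ℝ (1 : E → ℝ) x (-v) = 0 := by
        simp [lineDeriv]
      simp [this]
    · simp [hH, hx]
  rw [hr] at key
  rw [← integral_indicator hΩ.measurableSet, ← key]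
  refine integral_congr_ae ?_
  filter_upwards [hHabs.ae_lineDifferentiableAt (μ := volume) v] with x hx
  by_cases hxΩ : x ∈ Ω
  · have e1 : H =ᶠ[𝓝 x] F := by
      filter_upwards [hΩ.mem_nhds hxΩ, hχ1 x hxΩ] with y hy hy1
      simp [hH, hy, hy1]
    rw [e1.lineDeriv_eq, (hχ1 x hxΩ).eq_of_nhds,
      ((hF.differentiable (by simp)) x).lineDeriv_eq_fderiv]
    simp [hxΩ]
  · have e0 : H x = 0 := by simp [hH, hxΩ]
    have : lineDeriv ℝ H x v = 0 :=
      (kv_hasDerivAt_zero (h := fun t => H (x + t • v)) (by simp [e0]) hx).deriv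
    simp [hxΩ, this]

theorem kv_integrableOn {E : Type*} [NormedAddCommGroup E] [InnerProductSpace ℝ E]
    [FiniteDimensional ℝ E] [MeasurableSpace E] [BorelSpace E]
    {Ω : Set E} (hb : Bornology.IsBounded Ω) {f : E → ℝ} (hf : Continuous f) :
    IntegrableOn f Ω volume :=
  (hf.continuousOn.integrableOn_compact hb.isCompact_closure).mono_set subset_closure

/-- Green's first identity for a function vanishing on the boundary. -/
theorem kv_green {n : ℕ} {Ω : Set (EuclideanSpace ℝ (Fin n))}
    (hΩ : IsOpen Ω) (hb : Bornology.IsBounded Ω) {f g : EuclideanSpace ℝ (Fin n) → ℝ}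
    (hf : ContDiff ℝ (⊤ : ℕ∞) f) (hg : ContDiff ℝ (⊤ : ℕ∞) g)
    (h0 : ∀ x ∈ frontier Ω, f x = 0) :
    ∫ x in Ω, f x * lapl n g x = - ∫ x in Ω, ∑ i : Fin n,
      fderiv ℝ f x (EuclideanSpace.single i 1) * fderiv ℝ g x (EuclideanSpace.single i 1) := by
  have hdg : ∀ v, ContDiff ℝ (⊤ : ℕ∞) (fun y => fderiv ℝ g y v) := fun v =>
    (hg.fderiv_right (m := (⊤ : ℕ∞)) (by simp)).clm_apply contDiff_const
  have hdf : ∀ v, ContDiff ℝ (⊤ : ℕ∞) (fun y => fderiv ℝ f y v) := fun v =>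
    (hf.fderiv_right (m := (⊤ : ℕ∞)) (by simp)).clm_apply contDiff_const
  have hddg : ∀ v, ContDiff ℝ (⊤ : ℕ∞) (fun x => fderiv ℝ (fun y => fderiv ℝ g y v) x v) :=
    fun v => ((hdg v).fderiv_right (m := (⊤ : ℕ∞)) (by simp)).clm_apply contDiff_const
  have key : ∀ v, (∫ x in Ω, f x * fderiv ℝ (fun y => fderiv ℝ g y v) x v)
      = - ∫ x in Ω, fderiv ℝ f x v * fderiv ℝ g x v := by
    intro v
    have h1 := kv_integral_fderiv_eq_zero hΩ hb (F := fun x => f x * fderiv ℝ g x v)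
      ((hf.mul (hdg v)).of_le (by exact_mod_cast le_top)) (fun x hx => by simp [h0 x hx]) v
    have h2 : ∀ x, fderiv ℝ (fun x => f x * fderiv ℝ g x v) x v
        = f x * fderiv ℝ (fun y => fderiv ℝ g y v) x v + fderiv ℝ f x v * fderiv ℝ g x v := by
      intro x
      rw [fderiv_fun_mul (hf.differentiable (by simp) x) ((hdg v).differentiable (by simp) x)]
      simp
      ring
    simp_rw [h2] at h1
    have i1 : IntegrableOn (fun x => f x * fderiv ℝ (fun y => fderiv ℝ g y v) x v) Ω volume :=
      kv_integrableOn hb (hf.continuous.mul (hddg v).continuous)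
    have i2 : IntegrableOn (fun x => fderiv ℝ f x v * fderiv ℝ g x v) Ω volume :=
      kv_integrableOn hb ((hdf v).continuous.mul (hdg v).continuous)
    rw [integral_add i1 i2] at h1
    linarith
  simp only [lapl, Finset.mul_sum]
  rw [integral_finsetSum, integral_finsetSum, ← Finset.sum_neg_distrib]
  rotate_left
  · exact fun i _ => kv_integrableOn hb ((hdf _).continuous.mul (hdg _).continuous)
  · exact fun i _ => kv_integrableOn hb (hf.continuous.mul (hddg _).continuous)
  exact Finset.sum_congr rfl fun i _ => key _

theorem kv_green_symm {n : ℕ} {Ω : Set (EuclideanSpace ℝ (Fin n))}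
    (hΩ : IsOpen Ω) (hb : Bornology.IsBounded Ω) {f g : EuclideanSpace ℝ (Fin n) → ℝ}
    (hf : ContDiff ℝ (⊤ : ℕ∞) f) (hg : ContDiff ℝ (⊤ : ℕ∞) g)
    (h0 : ∀ x ∈ frontier Ω, f x = 0) (h0g : ∀ x ∈ frontier Ω, g x = 0) :
    ∫ x in Ω, f x * lapl n g x = ∫ x in Ω, lapl n f x * g x := by
  rw [kv_green hΩ hb hf hg h0]
  simp_rw [mul_comm (lapl n f _)]
  rw [kv_green hΩ hb hg hf h0g]
  simp_rw [mul_comm]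

/-- Differentiation under the integral sign. -/
theorem kv_hasDerivAt_integral {E : Type*} [NormedAddCommGroup E] [InnerProductSpace ℝ E]
    [FiniteDimensional ℝ E] [MeasurableSpace E] [BorelSpace E]
    {Ω : Set E} (hΩ : IsOpen Ω) (hb : Bornology.IsBounded Ω) {G G' : E → ℝ → ℝ}
    (hG : ∀ t, Continuous (fun x => G x t)) (hG' : Continuous (fun p : E × ℝ => G' p.1 p.2))
    (hd : ∀ x t, HasDerivAt (G x) (G' x t) t) (t : ℝ) :
    HasDerivAt (fun s => ∫ x in Ω, G x s) (∫ x in Ω, G' x t) t := by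
  have hK : IsCompact (closure Ω ×ˢ Metric.closedBall t 1) :=
    hb.isCompact_closure.prod (isCompact_closedBall t 1)
  obtain ⟨M, hM⟩ := hK.exists_bound_of_continuousOn hG'.continuousOn
  have hG't : Continuous (fun x => G' x t) := hG'.comp (by fun_prop : Continuous fun x : E => (x, t))
  refine (hasDerivAt_integral_of_dominated_loc_of_deriv_le (F := fun s x => G x s)
    (F' := fun s x => G' x s) (bound := fun _ => M) (μ := volume.restrict Ω)
    (Metric.closedBall_mem_nhds t one_pos)
    (Eventually.of_forall fun s => (hG s).aestronglyMeasurable)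
    (kv_integrableOn hb (hG t)) hG't.aestronglyMeasurable ?_ (kv_integrableOn hb continuous_const)
    (Eventually.of_forall fun x s _ => hd x s)).2
  filter_upwards [ae_restrict_mem hΩ.measurableSet] with x hx s hs
  exact hM (x, s) ⟨subset_closure hx, hs⟩

/-- Directional derivative of a function of space and time. -/
noncomputable def kvD {X : Type*} [NormedAddCommGroup X] [NormedSpace ℝ X]
    (v : X) (W : X → ℝ) (p : X) : ℝ := fderiv ℝ W p v

theorem kvD_smooth {X : Type*} [NormedAddCommGroup X] [NormedSpace ℝ X]
    (v : X) {W : X → ℝ} (hW : ContDiff ℝ (⊤ : ℕ∞) W) : ContDiff ℝ (⊤ : ℕ∞) (kvD v W) :=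
  (hW.fderiv_right (m := (⊤ : ℕ∞)) (by simp)).clm_apply contDiff_const

theorem kv_two_le : (2 : WithTop ℕ∞) ≤ ((⊤ : ℕ∞) : WithTop ℕ∞) :=
  WithTop.coe_le_coe.2 le_top

theorem kvD_comm {X : Type*} [NormedAddCommGroup X] [NormedSpace ℝ X]
    (v w : X) {W : X → ℝ} (hW : ContDiff ℝ (⊤ : ℕ∞) W) :
    kvD v (kvD w W) = kvD w (kvD v W) := by
  have hd : Differentiable ℝ (fderiv ℝ W) :=
    (hW.fderiv_right (m := (⊤ : ℕ∞)) (by simp)).differentiable (by simp)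
  have key : ∀ v w p, kvD v (kvD w W) p = fderiv ℝ (fderiv ℝ W) p v w := by
    intro v w p
    have : kvD w W = fun q => fderiv ℝ W q w := rfl
    rw [this, kvD, fderiv_clm_apply (hd p) (differentiableAt_const w)]
    simp
  ext p
  rw [key, key]
  exact (hW.contDiffAt.isSymmSndFDerivAt (by simpa using kv_two_le)) v w

/-- The spatial Laplacian of a function of space and time. -/
noncomputable def kvL (n : ℕ) (W : EuclideanSpace ℝ (Fin n) × ℝ → ℝ)
    (p : EuclideanSpace ℝ (Fin n) × ℝ) : ℝ :=
  ∑ i : Fin n, kvD (EuclideanSpace.single i (1 : ℝ), (0 : ℝ))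
    (kvD (EuclideanSpace.single i (1 : ℝ), (0 : ℝ)) W) p

/-- The time derivative of a function of space and time. -/
noncomputable def kvT (n : ℕ) (W : EuclideanSpace ℝ (Fin n) × ℝ → ℝ) :
    EuclideanSpace ℝ (Fin n) × ℝ → ℝ :=
  kvD (0, 1) W

theorem kvL_smooth {n : ℕ} {W : EuclideanSpace ℝ (Fin n) × ℝ → ℝ}
    (hW : ContDiff ℝ (⊤ : ℕ∞) W) : ContDiff ℝ (⊤ : ℕ∞) (kvL n W) :=
  ContDiff.sum fun _ _ => kvD_smooth _ (kvD_smooth _ hW)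

theorem kvT_smooth {n : ℕ} {W : EuclideanSpace ℝ (Fin n) × ℝ → ℝ}
    (hW : ContDiff ℝ (⊤ : ℕ∞) W) : ContDiff ℝ (⊤ : ℕ∞) (kvT n W) :=
  kvD_smooth _ hW

theorem kv_fderiv_slice {n : ℕ} {W : EuclideanSpace ℝ (Fin n) × ℝ → ℝ}
    (hW : ContDiff ℝ (⊤ : ℕ∞) W) (t : ℝ) (x v : EuclideanSpace ℝ (Fin n)) :
    fderiv ℝ (fun y => W (y, t)) x v = kvD (v, 0) W (x, t) := by
  have h1 : HasFDerivAt W (fderiv ℝ W (x, t)) (x, t) :=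
    (hW.differentiable (by simp) (x, t)).hasFDerivAt
  have h2 := h1.comp x (hasFDerivAt_prodMk_left (𝕜 := ℝ) x t)
  have h3 : fderiv ℝ (fun y => W (y, t)) x = _ := h2.fderiv
  rw [h3]
  simp [kvD]

theorem kv_hasDerivAt_slice {n : ℕ} {W : EuclideanSpace ℝ (Fin n) × ℝ → ℝ}
    (hW : ContDiff ℝ (⊤ : ℕ∞) W) (t : ℝ) (x : EuclideanSpace ℝ (Fin n)) :
    HasDerivAt (fun s => W (x, s)) (kvT n W (x, t)) t := by
  have h1 : HasFDerivAt W (fderiv ℝ W (x, t)) (x, t) :=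
    (hW.differentiable (by simp) (x, t)).hasFDerivAt
  have h2 := (h1.comp t (hasFDerivAt_prodMk_right (𝕜 := ℝ) x t)).hasDerivAt
  simpa [kvT, kvD, Function.comp_def] using h2

theorem kv_lapl_slice {n : ℕ} {W : EuclideanSpace ℝ (Fin n) × ℝ → ℝ}
    (hW : ContDiff ℝ (⊤ : ℕ∞) W) (t : ℝ) (x : EuclideanSpace ℝ (Fin n)) :
    lapl n (fun y => W (y, t)) x = kvL n W (x, t) := by
  simp only [lapl, kvL]
  refine Finset.sum_congr rfl fun i _ => ?_
  simp_rw [kv_fderiv_slice hW]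
  exact kv_fderiv_slice (kvD_smooth _ hW) t x _

theorem kvT_kvL {n : ℕ} {W : EuclideanSpace ℝ (Fin n) × ℝ → ℝ}
    (hW : ContDiff ℝ (⊤ : ℕ∞) W) : kvT n (kvL n W) = kvL n (kvT n W) := by
  ext p
  have h : kvT n (kvL n W) p = ∑ i : Fin n, kvD (0, 1)
      (kvD (EuclideanSpace.single i (1 : ℝ), (0 : ℝ))
        (kvD (EuclideanSpace.single i (1 : ℝ), (0 : ℝ)) W)) p := by
    have h1 : HasFDerivAt (kvL n W) (∑ i : Fin n, fderiv ℝ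
      (kvD (EuclideanSpace.single i (1 : ℝ), (0 : ℝ))
        (kvD (EuclideanSpace.single i (1 : ℝ), (0 : ℝ)) W)) p) p := by
      unfold kvL
      exact HasFDerivAt.fun_sum fun i _ =>
        ((kvD_smooth _ (kvD_smooth _ hW)).differentiable (by simp) p).hasFDerivAt
    simp only [kvT]
    rw [kvD, h1.fderiv]
    simp [kvD]
  rw [h]
  simp only [kvL, kvT]
  refine Finset.sum_congr rfl fun i _ => ?_
  rw [kvD_comm _ _ (kvD_smooth _ hW), kvD_comm (0, 1) _ hW]

/-- Slices of smooth functions are smooth. -/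
theorem kv_slice_smooth {n : ℕ} {W : EuclideanSpace ℝ (Fin n) × ℝ → ℝ}
    (hW : ContDiff ℝ (⊤ : ℕ∞) W) (t : ℝ) : ContDiff ℝ (⊤ : ℕ∞) (fun x => W (x, t)) :=
  hW.comp (contDiff_id.prodMk contDiff_const)

/-- If a smooth function vanishes at `x` for all times in a half line, so does its time
derivative in the interior. -/
theorem kvT_eq_zero {n : ℕ} {W : EuclideanSpace ℝ (Fin n) × ℝ → ℝ}
    (hW : ContDiff ℝ (⊤ : ℕ∞) W) {x : EuclideanSpace ℝ (Fin n)} {c t : ℝ} (hc : c < t)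
    (h0 : ∀ s, c ≤ s → W (x, s) = 0) : kvT n W (x, t) = 0 := by
  have h1 := kv_hasDerivAt_slice hW t x
  have h2 : (fun s => W (x, s)) =ᶠ[𝓝 t] fun _ => 0 := by
    filter_upwards [lt_mem_nhds hc] with s hs using h0 s hs.le
  exact h1.unique ((hasDerivAt_const t (0 : ℝ)).congr_of_eventuallyEq h2)

theorem kv_delay_hasDerivAt {g : ℝ → ℝ} (hg : Continuous g) {τ : ℝ} (hτ : 0 < τ) (t : ℝ) :
    HasDerivAt (fun s => ∫ ρ in (0 : ℝ)..1, g (s - τ * ρ)) (τ⁻¹ * (g t - g (t - τ))) t := by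
  have e : (fun s => ∫ ρ in (0 : ℝ)..1, g (s - τ * ρ)) =
      fun s => τ⁻¹ * ((∫ r in (0 : ℝ)..s, g r) - ∫ r in (0 : ℝ)..(s - τ), g r) := by
    ext s
    rw [intervalIntegral.integral_comp_sub_mul _ hτ.ne']
    rw [intervalIntegral.integral_interval_sub_left (hg.intervalIntegrable _ _)
      (hg.intervalIntegrable _ _)]
    simp
  rw [e]
  have h1 : ∀ s, HasDerivAt (fun s => ∫ r in (0 : ℝ)..s, g r) (g s) s := fun s =>
    intervalIntegral.integral_hasDerivAt_right (hg.intervalIntegrable _ _)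
      hg.stronglyMeasurable.stronglyMeasurableAtFilter hg.continuousAt
  have h2 := (h1 (t - τ)).comp t ((hasDerivAt_id t).sub_const τ)
  have h3 := ((h1 t).sub h2).const_mul τ⁻¹
  simpa [Function.comp_def] using h3

theorem kv_young {E : Type*} [NormedAddCommGroup E] [InnerProductSpace ℝ E]
    [FiniteDimensional ℝ E] [MeasurableSpace E] [BorelSpace E]
    {Ω : Set E} (hb : Bornology.IsBounded Ω) {f g : E → ℝ} (hf : Continuous f)
    (hg : Continuous g) {a : ℝ} (ha : 0 < a) {ε : ℝ} (hε : ε ^ 2 = 1) :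
    ε * ∫ x in Ω, f x * g x ≤ a / 4 * (∫ x in Ω, f x ^ 2) + 1 / a * ∫ x in Ω, g x ^ 2 := by
  have i1 : IntegrableOn (fun x => a / 4 * f x ^ 2) Ω volume := kv_integrableOn hb (by fun_prop)
  have i2 : IntegrableOn (fun x => 1 / a * g x ^ 2) Ω volume := kv_integrableOn hb (by fun_prop)
  rw [← integral_const_mul, ← integral_const_mul, ← integral_const_mul, ← integral_add i1 i2]
  refine integral_mono (kv_integrableOn hb (by fun_prop)) (i1.add i2) fun x => ?_
  have h : a / 4 * f x ^ 2 + 1 / a * g x ^ 2 - ε * (f x * g x)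
      = 1 / a * (a / 2 * f x - ε * g x) ^ 2 := by
    field_simp
    linear_combination (-4 * g x ^ 2 - 12 * g x ^ 2 * 1) * hε
  have h2 : 0 ≤ 1 / a * (a / 2 * f x - ε * g x) ^ 2 := by positivity
  show ε * (f x * g x) ≤ a / 4 * f x ^ 2 + 1 / a * g x ^ 2
  linarith

end KV

/-- Energy dissipation estimate for the delayed thermoelastic plate with
Kelvin–Voigt damping. -/
theorem energy_derivative_estimate_KVplate
    (n : ℕ) (hn : 1 ≤ n) (Ω : Set (EuclideanSpace ℝ (Fin n)))
    (hΩopen : IsOpen Ω) (hΩbdd : Bornology.IsBounded Ω)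
    (τ a ξ : ℝ) (hτ : 0 < τ) (ha : 0 < a) (hξ : 0 < ξ)
    (u θ : EuclideanSpace ℝ (Fin n) → ℝ → ℝ)
    (hsol : IsSmoothSolKVPlate n Ω τ a u θ) :
    ∀ t > (0 : ℝ),
      deriv (energyKVPlate n Ω τ ξ u θ) t ≤
        -(a / 2) * (∫ x in Ω, (lapl n (fun y => deriv (u y) t) x) ^ 2)
        + (1 / a + ξ / (2 * τ)) * (∫ x in Ω, (lapl n (fun y => u y t) x) ^ 2)
        - (∫ x in Ω, gradNormSq n (fun y => θ y t) x)
        + (1 / a - ξ / (2 * τ)) * (∫ x in Ω, (lapl n (fun y => u y (t - τ)) x) ^ 2) := by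

  intro t ht
  have hU := hsol.smooth_u
  have hΘ := hsol.smooth_θ
  set U : EuclideanSpace ℝ (Fin n) × ℝ → ℝ := fun p => u p.1 p.2 with hUdef
  set Θ : EuclideanSpace ℝ (Fin n) × ℝ → ℝ := fun p => θ p.1 p.2 with hΘdef
  have hV := kvT_smooth hU
  set V := kvT n U with hVdef
  have hLU := kvL_smooth hU
  have hLV := kvL_smooth hV
  have hLΘ := kvL_smooth hΘ
  have hTV := kvT_smooth hV
  have hTΘ := kvT_smooth hΘ
  have hTLU : kvT n (kvL n U) = kvL n V := kvT_kvL hU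
  have eV : ∀ x s, deriv (u x) s = V (x, s) := fun x s => (kv_hasDerivAt_slice hU s x).deriv
  have eTV : ∀ x s, deriv (deriv (u x)) s = kvT n V (x, s) := fun x s => by
    have : deriv (u x) = fun s => V (x, s) := funext (eV x)
    rw [this]
    exact (kv_hasDerivAt_slice hV s x).deriv
  have eLU : ∀ s x, lapl n (fun y => u y s) x = kvL n U (x, s) := fun s x => kv_lapl_slice hU s x
  have eLΘ : ∀ s x, lapl n (fun y => θ y s) x = kvL n Θ (x, s) := fun s x => kv_lapl_slice hΘ s x
  have eLV : ∀ s x, lapl n (fun y => deriv (u y) s) x = kvL n V (x, s) := fun s x => by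
    simp_rw [eV]
    exact kv_lapl_slice hV s x
  have eTΘ : ∀ x s, deriv (θ x) s = kvT n Θ (x, s) := fun x s =>
    (kv_hasDerivAt_slice hΘ s x).deriv
  -- boundary conditions
  have bU : ∀ x ∈ frontier Ω, ∀ s, -τ ≤ s → U (x, s) = 0 := fun x hx s hs =>
    (hsol.bc_u x hx s hs).1
  have bLU : ∀ x ∈ frontier Ω, ∀ s, -τ ≤ s → kvL n U (x, s) = 0 := fun x hx s hs => by
    rw [← eLU]
    exact (hsol.bc_u x hx s hs).2
  have bV : ∀ x ∈ frontier Ω, V (x, t) = 0 := fun x hx =>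
    kvT_eq_zero hU (by linarith : -τ < t) (bU x hx)
  have bLV : ∀ x ∈ frontier Ω, kvL n V (x, t) = 0 := fun x hx => by
    rw [← hTLU]
    exact kvT_eq_zero hLU (by linarith : -τ < t) (bLU x hx)
  have bΘ : ∀ x ∈ frontier Ω, Θ (x, t) = 0 := fun x hx => hsol.bc_θ x hx t ht.le
  -- equations
  have pU : ∀ x ∈ Ω, kvT n V (x, t) = -kvL n (kvL n U) (x, t - τ) - a * kvL n (kvL n V) (x, t)
      - kvL n Θ (x, t) := fun x hx => by
    have h := hsol.pde_u x hx t ht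
    simp_rw [eTV, eLU, eLV, eLΘ] at h
    rw [kv_lapl_slice hLU, kv_lapl_slice hLV] at h
    linarith
  have pΘ : ∀ x ∈ Ω, kvT n Θ (x, t) = kvL n Θ (x, t) + kvL n V (x, t) := fun x hx => by
    have h := hsol.pde_θ x hx t ht
    simp_rw [eTΘ, eLV, eLΘ] at h
    linarith
  -- Green identities
  have g1 := kv_green_symm hΩopen hΩbdd (kv_slice_smooth hV t) (kv_slice_smooth hLU (t - τ)) bV
    (fun x hx => bLU x hx (t - τ) (by linarith))
  have g2 := kv_green_symm hΩopen hΩbdd (kv_slice_smooth hV t) (kv_slice_smooth hLV t) bV bLV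
  have g3 := kv_green_symm hΩopen hΩbdd (kv_slice_smooth hV t) (kv_slice_smooth hΘ t) bV bΘ
  have g4 := kv_green hΩopen hΩbdd (kv_slice_smooth hΘ t) (kv_slice_smooth hΘ t) bΘ
  simp_rw [kv_lapl_slice hLU, kv_lapl_slice hV] at g1
  simp_rw [kv_lapl_slice hLV, kv_lapl_slice hV] at g2
  simp_rw [kv_lapl_slice hΘ, kv_lapl_slice hV] at g3
  simp_rw [kv_lapl_slice hΘ] at g4
  have g4' : ∫ x in Ω, Θ (x, t) * kvL n Θ (x, t) = - ∫ x in Ω, gradNormSq n (fun y => θ y t) x := by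
    rw [g4]
    simp only [gradNormSq, pow_two]
    rfl
  -- continuity
  have cU := hU.continuous
  have cΘ := hΘ.continuous
  have cV := hV.continuous
  have cLU := hLU.continuous
  have cLV := hLV.continuous
  have cLΘ := hLΘ.continuous
  have cTV := hTV.continuous
  have cTΘ := hTΘ.continuous
  have cLLU := (kvL_smooth hLU).continuous
  have cLLV := (kvL_smooth hLV).continuous
  -- derivative of the energy
  have d1 : HasDerivAt (fun s => ∫ x in Ω, (V (x, s) ^ 2 + kvL n U (x, s) ^ 2 + Θ (x, s) ^ 2))
      (∫ x in Ω, (2 * (V (x, t) * kvT n V (x, t)) + 2 * (kvL n V (x, t) * kvL n U (x, t))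
        + 2 * (Θ (x, t) * kvT n Θ (x, t)))) t := by
    refine kv_hasDerivAt_integral hΩopen hΩbdd
      (G := fun x s => V (x, s) ^ 2 + kvL n U (x, s) ^ 2 + Θ (x, s) ^ 2)
      (G' := fun x s => 2 * (V (x, s) * kvT n V (x, s)) + 2 * (kvL n V (x, s) * kvL n U (x, s))
        + 2 * (Θ (x, s) * kvT n Θ (x, s))) (fun s => by fun_prop) (by fun_prop) (fun x s => ?_) t
    have h1 := (kv_hasDerivAt_slice hV s x).fun_pow 2
    have h2 := (kv_hasDerivAt_slice hLU s x).fun_pow 2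
    have h3 := (kv_hasDerivAt_slice hΘ s x).fun_pow 2
    rw [hTLU] at h2
    refine ((h1.fun_add h2).fun_add h3).congr_deriv ?_
    push_cast
    ring
  have d2 : HasDerivAt (fun s => ∫ x in Ω, ∫ ρ in (0 : ℝ)..1, kvL n U (x, s - τ * ρ) ^ 2)
      (∫ x in Ω, τ⁻¹ * (kvL n U (x, t) ^ 2 - kvL n U (x, t - τ) ^ 2)) t := by
    refine kv_hasDerivAt_integral hΩopen hΩbdd
      (G := fun x s => ∫ ρ in (0 : ℝ)..1, kvL n U (x, s - τ * ρ) ^ 2)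
      (G' := fun x s => τ⁻¹ * (kvL n U (x, s) ^ 2 - kvL n U (x, s - τ) ^ 2))
      (fun s => ?_) (by fun_prop) (fun x s => ?_) t
    · apply intervalIntegral.continuous_parametric_intervalIntegral_of_continuous'
      simp only [Function.uncurry_def]
      fun_prop
    · exact kv_delay_hasDerivAt (g := fun r => kvL n U (x, r) ^ 2) (by fun_prop) hτ s
  have eE : energyKVPlate n Ω τ ξ u θ = fun s => (1 / 2) *
      ((∫ x in Ω, (V (x, s) ^ 2 + kvL n U (x, s) ^ 2 + Θ (x, s) ^ 2))
        + ξ * ∫ x in Ω, ∫ ρ in (0 : ℝ)..1, kvL n U (x, s - τ * ρ) ^ 2) := by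
    ext s
    simp only [energyKVPlate, eV, eLU]
    rfl
  have dE := (d1.fun_add (d2.const_mul ξ)).const_mul (1 / 2)
  rw [eE, dE.deriv]
  simp_rw [eLV, eLU]
  -- rewriting the derivative
  have r1 : (∫ x in Ω, (2 * (V (x, t) * kvT n V (x, t)) + 2 * (kvL n V (x, t) * kvL n U (x, t))
        + 2 * (Θ (x, t) * kvT n Θ (x, t))))
      = ∫ x in Ω, ((-2) * (V (x, t) * kvL n (kvL n U) (x, t - τ))
        + (-2 * a) * (V (x, t) * kvL n (kvL n V) (x, t))
        + (-2) * (V (x, t) * kvL n Θ (x, t))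
        + 2 * (kvL n V (x, t) * kvL n U (x, t))
        + 2 * (Θ (x, t) * kvL n Θ (x, t))
        + 2 * (kvL n V (x, t) * Θ (x, t))) := by
    refine setIntegral_congr_fun hΩopen.measurableSet fun x hx => ?_
    simp only [pU x hx, pΘ x hx]
    ring
  have I : ∀ {f : EuclideanSpace ℝ (Fin n) → ℝ}, Continuous f → Integrable f (volume.restrict Ω) :=
    fun hf => kv_integrableOn hΩbdd hf
  conv_rhs at r1 =>
    rw [integral_add (I (by fun_prop)) (I (by fun_prop)),
      integral_add (I (by fun_prop)) (I (by fun_prop)),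
      integral_add (I (by fun_prop)) (I (by fun_prop)),
      integral_add (I (by fun_prop)) (I (by fun_prop)),
      integral_add (I (by fun_prop)) (I (by fun_prop))]
  simp only [integral_const_mul] at r1
  rw [g1, g2, g3, g4'] at r1
  have r2 : (∫ x in Ω, τ⁻¹ * (kvL n U (x, t) ^ 2 - kvL n U (x, t - τ) ^ 2))
      = τ⁻¹ * ((∫ x in Ω, kvL n U (x, t) ^ 2) - ∫ x in Ω, kvL n U (x, t - τ) ^ 2) := by
    rw [integral_const_mul, integral_sub (I (by fun_prop)) (I (by fun_prop))]
  rw [r1, r2]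
  have y1 := kv_young hΩbdd (f := fun x => kvL n V (x, t)) (g := fun x => kvL n U (x, t - τ))
    (by fun_prop) (by fun_prop) ha (ε := -1) (by norm_num)
  have y2 := kv_young hΩbdd (f := fun x => kvL n V (x, t)) (g := fun x => kvL n U (x, t))
    (by fun_prop) (by fun_prop) ha (ε := 1) (by norm_num)
  simp only [← pow_two]
  have e1 : ξ / (2 * τ) = 1 / 2 * (ξ * τ⁻¹) := by field_simp
  rw [e1]
  linarith
end
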